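/- arXiv:1305.3238 — 4 statements merged into one kernel-verified Lean document; each statement's English description precedes it below -/
import Mathlib

section
/- Let k ≥ 1 be an integer, let α be a real number with 0 < α < 1, and let s be a complex number that is not an integer ≤ 1 (i.e. s ≠ m for every integer m ≤ 1). Then ζ(s,α) = Σ_{n=0}^{k−1} (n+α)^{−s} + Σ_{n≥0} c_{n,k}(s)·(−α)^n/n!, where the infinite series on the right is summable. -/
noncomputable def zetaK (k : ℕ) (s : ℂ) : ℂ :=
  riemannZeta s - ∑ m ∈ Finset.Ico 1 k, (m : ℂ) ^ (-s)

noncomputable def c (n k : ℕ) (s : ℂ) : ℂ :=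
  (∏ j ∈ Finset.range n, (s + j)) * zetaK k (s + n)

lemma aux_choose (s : ℂ) (n : ℕ) :
    Ring.choose (-s) n = (-1) ^ n * (∏ j ∈ Finset.range n, (s + j)) / (n.factorial : ℂ) := by
  have h1 : (ascPochhammer ℕ n).smeval s = ∏ j ∈ Finset.range n, (s + j) := by
    induction n with
    | zero => simp
    | succ n ih =>
      rw [Finset.prod_range_succ, ← ih, ascPochhammer_succ_right, Polynomial.smeval_mul,
        Polynomial.smeval_add, Polynomial.smeval_X, Polynomial.smeval_natCast]
      simp
  have h2 := Ring.factorial_nsmul_multichoose_eq_ascPochhammer s n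
  rw [h1, nsmul_eq_mul] at h2
  have h3 : (n.factorial : ℂ) ≠ 0 := by exact_mod_cast n.factorial_ne_zero
  rw [Ring.choose_neg, ← h2]
  field_simp
  simp [Units.smul_def, Int.negOnePow_def, Ring.multichoose_eq]

lemma aux_binom (s z : ℂ) (hz : ‖z‖ < 1) :
    HasSum (fun n : ℕ => (∏ j ∈ Finset.range n, (s + j)) * (-z) ^ n / (n.factorial : ℂ))
      ((1 + z) ^ (-s)) := by
  have h := (Complex.one_add_cpow_hasFPowerSeriesOnBall_zero (a := -s)).hasSum (y := z) (by
    rw [Metric.mem_eball, edist_zero_right, ← ofReal_norm, ENNReal.ofReal_lt_one]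
    exact hz)
  simp only [zero_add] at h
  convert! h using 1
  ext n
  rw [binomialSeries_apply, aux_choose]
  simp only [List.ofFn_const, List.prod_replicate, smul_eq_mul]
  rw [neg_pow z]
  ring

lemma aux_sum (R α : ℝ) (hR : 0 < R) (h0 : 0 < α) (h1 : α < 1) :
    Summable (fun n : ℕ => (∏ j ∈ Finset.range n, (R + j)) * α ^ n / (n.factorial : ℝ)) := by
  have hp : ∀ n : ℕ, 0 < (∏ j ∈ Finset.range n, (R + j)) * α ^ n / (n.factorial : ℝ) := by
    intro n
    have : 0 < ∏ j ∈ Finset.range n, (R + j) := Finset.prod_pos fun i _ => by positivity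
    positivity
  refine summable_of_ratio_test_tendsto_lt_one h1 (Filter.Eventually.of_forall fun n => (hp n).ne') ?_
  have key : ∀ n : ℕ, ‖(∏ j ∈ Finset.range (n+1), (R + j)) * α ^ (n+1) / ((n+1).factorial : ℝ)‖ /
      ‖(∏ j ∈ Finset.range n, (R + j)) * α ^ n / (n.factorial : ℝ)‖
      = α * (1 + (R - 1) * (1 / ((n:ℝ) + 1))) := by
    intro n
    rw [Real.norm_of_nonneg (hp _).le, Real.norm_of_nonneg (hp _).le, div_eq_iff (hp n).ne',
      Finset.prod_range_succ, Nat.factorial_succ]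
    push_cast
    have : (n.factorial : ℝ) ≠ 0 := by exact_mod_cast n.factorial_ne_zero
    field_simp
    ring
  simp_rw [key]
  have := (((tendsto_one_div_add_atTop_nhds_zero_nat (𝕜 := ℝ)).const_mul (R-1)).const_add 1).const_mul α
  simpa using this

lemma aux_zetaK (k : ℕ) (hk : 1 ≤ k) (w : ℂ) (hw : 1 < w.re) :
    HasSum (fun m : ℕ => ((m + k : ℕ) : ℂ) ^ (-w)) (zetaK k w) := by
  have hs : Summable (fun m : ℕ => (m : ℂ) ^ (-w)) := by
    simpa [Complex.cpow_neg] using Complex.summable_one_div_nat_cpow.2 hw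
  have h := (hasSum_nat_add_iff' k).2 hs.hasSum
  refine (?_ : zetaK k w = _) ▸ h
  rw [zetaK, zeta_eq_tsum_one_div_nat_cpow hw]
  have hw0 : w ≠ 0 := by rintro rfl; simp at hw; linarith
  simp only [one_div, Complex.cpow_neg]
  congr 1
  rw [Finset.range_eq_Ico, Finset.sum_eq_sum_Ico_succ_bot (show 0 < k by omega)]
  simp [hw0]

lemma aux_norm (k : ℕ) (hk : 1 ≤ k) (w : ℂ) (m : ℕ) :
    ‖((m + k : ℕ) : ℂ) ^ (-w)‖ = ((m + k : ℕ) : ℝ) ^ (-w.re) := by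
  rw [Complex.norm_natCast_cpow_of_pos (by omega)]
  simp

lemma aux_rsum (k : ℕ) (x : ℝ) (hx : 1 < x) :
    Summable (fun m : ℕ => ((m + k : ℕ) : ℝ) ^ (-x)) :=
  (summable_nat_add_iff (f := fun m : ℕ => (m : ℝ) ^ (-x)) k).2
    (Real.summable_nat_rpow.2 (by linarith))

lemma aux_bound (k : ℕ) (hk : 1 ≤ k) (w : ℂ) (hw : 2 ≤ w.re) :
    ‖zetaK k w‖ ≤ ∑' m : ℕ, ((m + k : ℕ) : ℝ) ^ (-(2:ℝ)) := by
  rw [← (aux_zetaK k hk w (by linarith)).tsum_eq]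
  refine tsum_of_norm_bounded (aux_rsum k 2 (by norm_num)).hasSum fun m => ?_
  rw [aux_norm k hk]
  apply Real.rpow_le_rpow_of_exponent_le _ (by linarith)
  exact_mod_cast (by omega : 1 ≤ m + k)

lemma aux_prod (s : ℂ) (R : ℝ) (hs : ‖s‖ ≤ R) (n : ℕ) :
    ‖∏ j ∈ Finset.range n, (s + j)‖ ≤ ∏ j ∈ Finset.range n, (R + j) := by
  rw [norm_prod]
  refine Finset.prod_le_prod (fun _ _ => norm_nonneg _) fun j _ => ?_
  calc ‖s + j‖ ≤ ‖s‖ + ‖(j:ℂ)‖ := norm_add_le _ _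
    _ ≤ R + j := by simp [hs]

lemma aux_F (k : ℕ) (hk : 1 ≤ k) (α R : ℝ) (h0 : 0 < α) (s : ℂ)
    (hs : ‖s‖ ≤ R) (n : ℕ) (hn : R + 2 ≤ n) :
    ‖c n k s * (-(α : ℂ)) ^ n / (n.factorial : ℂ)‖ ≤
      (∑' m : ℕ, ((m + k : ℕ) : ℝ) ^ (-(2:ℝ))) *
        ((∏ j ∈ Finset.range n, (R + j)) * α ^ n / (n.factorial : ℝ)) := by
  have hre : 2 ≤ (s + n).re := by
    have := Complex.abs_re_le_norm s
    have := neg_abs_le s.re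
    simp
    linarith
  have hb := aux_bound k hk (s + n) hre
  have hp := aux_prod s R hs n
  rw [norm_div, norm_mul, norm_pow, norm_neg, Complex.norm_real, Real.norm_of_nonneg h0.le, c,
    norm_mul, Complex.norm_natCast]
  have := (norm_nonneg _).trans hp
  calc _ ≤ (∏ j ∈ Finset.range n, (R + j)) * (∑' m : ℕ, ((m + k : ℕ) : ℝ) ^ (-(2:ℝ))) * α ^ n /
        (n.factorial : ℝ) := by gcongr
    _ = _ := by ring

lemma aux_summable (k : ℕ) (hk : 1 ≤ k) (α : ℝ) (h0 : 0 < α) (h1 : α < 1) (s : ℂ) :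
    Summable (fun n : ℕ => c n k s * (-(α : ℂ)) ^ n / (n.factorial : ℂ)) := by
  refine Summable.of_norm_bounded_eventually_nat
    ((aux_sum (‖s‖ + 1) α (by positivity) h0 h1).mul_left
      (∑' m : ℕ, ((m + k : ℕ) : ℝ) ^ (-(2:ℝ)))) ?_
  filter_upwards [Filter.eventually_ge_atTop ⌈‖s‖ + 1 + 2⌉₊] with n hn
  exact aux_F k hk α _ h0 s (by linarith) n (Nat.ceil_le.1 hn)

lemma aux_cdiff (k n : ℕ) (hk : 1 ≤ k) (s : ℂ) (hs : s + n ≠ 1) :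
    DifferentiableAt ℂ (fun s => c n k s) s := by
  unfold c zetaK
  refine DifferentiableAt.mul (by fun_prop) (DifferentiableAt.sub ?_ ?_)
  · exact (differentiableAt_riemannZeta hs).comp s (by fun_prop : DifferentiableAt ℂ (fun s : ℂ => s + n) s)
  · refine DifferentiableAt.fun_sum fun m hm => ?_
    have : (m:ℂ) ≠ 0 := by
      have := (Finset.mem_Ico.1 hm).1
      exact_mod_cast (by omega : m ≠ 0)
    exact DifferentiableAt.const_cpow (by fun_prop) (Or.inl this)

lemma aux_diff (k : ℕ) (hk : 1 ≤ k) (α : ℝ) (h0 : 0 < α) (h1 : α < 1) (s : ℂ)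
    (hs : ∀ m : ℤ, m ≤ 1 → s ≠ (m : ℂ)) :
    DifferentiableAt ℂ (fun s => ∑' n : ℕ, c n k s * (-(α : ℂ)) ^ n / (n.factorial : ℂ)) s := by
  set R := ‖s‖ + 1 with hR
  set N := ⌈R + 2⌉₊ with hN
  have hNR : R + 2 ≤ N := Nat.le_ceil _
  have heq : (fun s => ∑' n : ℕ, c n k s * (-(α : ℂ)) ^ n / (n.factorial : ℂ)) =
      fun s => ∑ n ∈ Finset.range N, c n k s * (-(α : ℂ)) ^ n / (n.factorial : ℂ) +
        ∑' n : ℕ, c (n + N) k s * (-(α : ℂ)) ^ (n + N) / ((n + N).factorial : ℂ) := by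
    ext z
    exact ((aux_summable k hk α h0 h1 z).sum_add_tsum_nat_add N).symm
  rw [heq]
  refine DifferentiableAt.add ?_ ?_
  · refine DifferentiableAt.fun_sum fun n _ => ?_
    refine ((aux_cdiff k n hk s ?_).mul_const _).div_const _
    intro h
    refine hs (1 - n) (by omega) ?_
    push_cast
    linear_combination h
  · have hD : DifferentiableOn ℂ
        (fun s => ∑' n : ℕ, c (n + N) k s * (-(α : ℂ)) ^ (n + N) / ((n + N).factorial : ℂ))
        (Metric.ball 0 R) := by
      refine Complex.differentiableOn_tsum_of_summable_norm
        (u := fun n => (∑' m : ℕ, ((m + k : ℕ) : ℝ) ^ (-(2:ℝ))) *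
          ((∏ j ∈ Finset.range (n + N), (R + j)) * α ^ (n + N) / ((n + N).factorial : ℝ)))
        ?_ ?_ Metric.isOpen_ball ?_
      · exact (summable_nat_add_iff N).2 ((aux_sum R α (by positivity) h0 h1).mul_left _)
      · intro n z hz
        refine (((aux_cdiff k (n + N) hk z ?_).mul_const _).div_const _).differentiableWithinAt
        intro h
        have h2 := congrArg Complex.re h
        simp at h2 hz
        have := Complex.abs_re_le_norm z
        have := neg_abs_le z.re
        have : (0:ℝ) ≤ n := by positivity
        linarith
      · intro n z hz
        simp at hz
        refine aux_F k hk α R h0 z hz.le (n + N) ?_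
        push_cast
        have : (0:ℝ) ≤ n := by positivity
        linarith
    exact hD.differentiableAt (Metric.isOpen_ball.mem_nhds (by simp [hR]))

lemma aux_eq (k : ℕ) (hk : 1 ≤ k) (α : ℝ) (h0 : 0 < α) (h1 : α < 1) (s : ℂ) (hs : 1 < s.re) :
    HurwitzZeta.hurwitzZeta (α : UnitAddCircle) s
      = ∑ n ∈ Finset.range k, ((n : ℂ) + α) ^ (-s)
        + ∑' n : ℕ, c n k s * (-(α : ℂ)) ^ n / (n.factorial : ℂ) := by
  have hH := HurwitzZeta.hasSum_hurwitzZeta_of_one_lt_re (a := α) ⟨h0.le, h1.le⟩ hs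
  simp only [one_div, ← Complex.cpow_neg] at hH
  rw [← hH.tsum_eq, ← hH.summable.sum_add_tsum_nat_add k]
  congr 1
  let f : ℕ → ℕ → ℂ := fun m n =>
    ((m + k : ℕ) : ℂ) ^ (-(s + n)) * ((∏ j ∈ Finset.range n, (s + j)) * (-(α:ℂ)) ^ n / (n.factorial : ℂ))
  have hrow : ∀ m : ℕ, (((m + k : ℕ) : ℂ) + α) ^ (-s) = ∑' n, f m n := by
    intro m
    have hpos : (0:ℝ) < ((m + k : ℕ) : ℝ) := by exact_mod_cast (by omega : 0 < m + k)
    have hne : ((m + k : ℕ) : ℂ) ≠ 0 := by exact_mod_cast (by omega : m + k ≠ 0)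
    have h1le : (1:ℝ) ≤ ((m + k : ℕ) : ℝ) := by exact_mod_cast (by omega : 1 ≤ m + k)
    have hz : ‖((α / ((m + k : ℕ) : ℝ) : ℝ) : ℂ)‖ < 1 := by
      rw [Complex.norm_real, Real.norm_of_nonneg (by positivity), div_lt_one hpos]
      linarith
    have hb := (aux_binom s _ hz).mul_left (((m + k : ℕ) : ℂ) ^ (-s))
    have e : (((m + k : ℕ) : ℂ) + α) ^ (-s) = ((m + k : ℕ) : ℂ) ^ (-s) *
        (1 + ((α / ((m + k : ℕ) : ℝ) : ℝ) : ℂ)) ^ (-s) := by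
      have := Complex.mul_cpow_ofReal_nonneg hpos.le
        (by positivity : (0:ℝ) ≤ 1 + α / ((m + k : ℕ) : ℝ)) (-s)
      rw [Complex.ofReal_natCast, Complex.ofReal_add, Complex.ofReal_one] at this
      rw [← this]
      congr 1
      rw [Complex.ofReal_div, Complex.ofReal_natCast]
      field_simp
    rw [e, ← hb.tsum_eq]
    congr 1
    ext n
    simp only [f]
    rw [neg_add, Complex.cpow_add _ _ hne, Complex.cpow_neg _ (n:ℂ), Complex.cpow_natCast,
      Complex.ofReal_div, Complex.ofReal_natCast, ← neg_div, div_pow]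
    ring
  have hcol : ∀ n : ℕ, c n k s * (-(α : ℂ)) ^ n / (n.factorial : ℂ) = ∑' m, f m n := by
    intro n
    have := aux_zetaK k hk (s + n) (by simp only [Complex.add_re, Complex.natCast_re]; have : (0:ℝ) ≤ n := n.cast_nonneg; linarith)
    simp only [f]
    rw [tsum_mul_right, this.tsum_eq, c]
    ring
  rw [tsum_congr hrow, tsum_congr hcol]
  refine (Summable.tsum_comm (f := f) ?_).symm
  have hmaj := (aux_rsum k s.re hs).mul_of_nonneg (aux_sum (‖s‖ + 1) α (by positivity) h0 h1)
    (fun m => by positivity) (fun n => by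
      have : 0 ≤ ∏ j ∈ Finset.range n, (‖s‖ + 1 + (j:ℝ)) := Finset.prod_nonneg fun i _ => by positivity
      positivity)
  refine Summable.of_norm_bounded hmaj ?_
  rintro ⟨m, n⟩
  simp only [Function.uncurry, f]
  rw [norm_mul, aux_norm k hk, norm_div, norm_mul, norm_pow, norm_neg, Complex.norm_real,
    Real.norm_of_nonneg h0.le, Complex.norm_natCast]
  have hp := aux_prod s (‖s‖ + 1) (by linarith) n
  have h1le : (1:ℝ) ≤ ((m + k : ℕ) : ℝ) := by exact_mod_cast (by omega : 1 ≤ m + k)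
  have : -(s + n).re ≤ -s.re := by simp
  gcongr

theorem stmt_5 (k : ℕ) (hk : 1 ≤ k) (α : ℝ) (hα0 : 0 < α) (hα1 : α < 1)
    (s : ℂ) (hs : ∀ m : ℤ, m ≤ 1 → s ≠ (m : ℂ)) :
    Summable (fun n : ℕ => c n k s * (-(α : ℂ)) ^ n / (n.factorial : ℂ)) ∧
    HurwitzZeta.hurwitzZeta (α : UnitAddCircle) s
      = ∑ n ∈ Finset.range k, ((n : ℂ) + α) ^ (-s)
        + ∑' n : ℕ, c n k s * (-(α : ℂ)) ^ n / (n.factorial : ℂ) := by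
  refine ⟨aux_summable k hk α hα0 hα1 s, ?_⟩
  set T : Set ℂ := (fun m : ℤ => (m : ℂ)) '' {m : ℤ | m ≤ 1} with hT
  have hmem : ∀ z : ℂ, z ∈ Tᶜ ↔ ∀ m : ℤ, m ≤ 1 → z ≠ (m : ℂ) := by
    intro z
    simp only [hT, Set.mem_compl_iff, Set.mem_image, Set.mem_ofPred_eq, not_exists, not_and]
    exact forall_congr' fun m => imp_congr_right fun _ => ne_comm
  have hcl : IsClosed T := by
    have hce : Topology.IsClosedEmbedding (fun m : ℤ => (m : ℂ)) := by
      have := Complex.isometry_ofReal.isClosedEmbedding.comp Int.isClosedEmbedding_coe_real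
      convert this using 1
      ext m
      simp
    exact hce.isClosedMap _ (isClosed_discrete _)
  have hpre : IsPreconnected Tᶜ := by
    have hc : T.Countable := (Set.to_countable _).image _
    exact (hc.isConnected_compl_of_one_lt_rank (by simp)).isPreconnected
  have h2 : (2 : ℂ) ∈ Tᶜ := by
    rw [hmem]
    intro m hm h
    have : (2 : ℤ) = m := by exact_mod_cast h
    omega
  refine AnalyticOnNhd.eqOn_of_preconnected_of_eventuallyEq (𝕜 := ℂ)
    (f := fun s => HurwitzZeta.hurwitzZeta (α : UnitAddCircle) s)
    (g := fun s => ∑ n ∈ Finset.range k, ((n : ℂ) + α) ^ (-s)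
        + ∑' n : ℕ, c n k s * (-(α : ℂ)) ^ n / (n.factorial : ℂ))
    ?_ ?_ hpre h2 ?_ ((hmem s).2 hs)
  · refine DifferentiableOn.analyticOnNhd (fun z hz => ?_) hcl.isOpen_compl
    refine (HurwitzZeta.differentiableAt_hurwitzZeta _ ?_).differentiableWithinAt
    simpa using (hmem z).1 hz 1 le_rfl
  · refine DifferentiableOn.analyticOnNhd (fun z hz => ?_) hcl.isOpen_compl
    refine (DifferentiableAt.add ?_
      (aux_diff k hk α hα0 hα1 z ((hmem z).1 hz))).differentiableWithinAt
    refine DifferentiableAt.fun_sum fun n _ => ?_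
    refine DifferentiableAt.const_cpow (by fun_prop) (Or.inl ?_)
    have : (0:ℝ) < n + α := by positivity
    exact_mod_cast this.ne'
  · filter_upwards [(isOpen_lt continuous_const Complex.continuous_re).mem_nhds
      (show (1:ℝ) < (2:ℂ).re by norm_num)] with z hz
    exact aux_eq k hk α hα0 hα1 z hz
end

section
/- Let k ≥ 1 and r ≥ 1 be integers, let α be a real number with 0 < α < 1, and let s be a complex number that is not an integer ≤ 1. Then the r-th derivative in s of the Hurwitz zeta function satisfies ζ^{(r)}(s,α) = Σ_{n=0}^{k−1} (−1)^r (n+α)^{−s} (log(n+α))^r + Σ_{n≥0} (iteratedDeriv r c_{n,k})(s) · (−α)^n/n!, where ζ^{(r)}(s,α) = iteratedDeriv r (fun w => ζ(w,α)) s, the logarithm log(n+α) is the real logarithm of the positive real number n+α, and iteratedDeriv r c_{n,k} is the r-th complex derivative of the function w ↦ c_{n,k}(w); the infinite series on the right is summable. -/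
open Filter Topology

lemma hs_deriv {f : ℕ → ℂ → ℂ} {g : ℂ → ℂ} {U : Set ℂ} (hU : IsOpen U)
    (hf : ∀ n, DifferentiableOn ℂ (f n) U)
    (h : TendstoLocallyUniformlyOn (fun (t : Finset ℕ) x => ∑ n ∈ t, f n x) g atTop U) (r : ℕ) :
    (∀ n, DifferentiableOn ℂ (iteratedDeriv r (f n)) U) ∧ DifferentiableOn ℂ (iteratedDeriv r g) U ∧
    TendstoLocallyUniformlyOn (fun (t : Finset ℕ) x => ∑ n ∈ t, iteratedDeriv r (f n) x)
      (iteratedDeriv r g) atTop U := by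
  induction r with
  | zero =>
    simp only [iteratedDeriv_zero]
    refine ⟨hf, h.differentiableOn (Eventually.of_forall fun t => ?_) hU, h⟩
    exact DifferentiableOn.fun_sum fun i _ => hf i
  | succ r ih =>
    obtain ⟨h1, h2, h3⟩ := ih
    simp only [iteratedDeriv_succ]
    refine ⟨fun n => (h1 n).deriv hU, h2.deriv hU, ?_⟩
    have := h3.deriv (Eventually.of_forall fun t => DifferentiableOn.fun_sum fun i _ => h1 i) hU
    refine this.congr fun t x hx => ?_
    simp only [Function.comp]
    rw [deriv_fun_sum]
    intro i _
    exact (h1 i).differentiableAt (hU.mem_nhds hx)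

lemma iter_cpow (a : ℝ) (ha : 0 < a) (r : ℕ) (s : ℂ) :
    iteratedDeriv r (fun w : ℂ => (a : ℂ) ^ (-w)) s = (-1) ^ r * (a : ℂ) ^ (-s) * (Real.log a : ℂ) ^ r := by
  have h : (fun w : ℂ => (a : ℂ) ^ (-w)) = fun w => Complex.exp ((-(Real.log a : ℂ)) * w) := by
    ext w
    rw [Complex.cpow_def_of_ne_zero (by exact_mod_cast ha.ne'), ← Complex.ofReal_log ha.le]
    congr 1; ring
  have h' := congrFun h s
  rw [h, iteratedDeriv_cexp_const_mul, h', neg_pow]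
  ring

lemma asc_prod (w : ℂ) (n : ℕ) :
    (ascPochhammer ℂ n).eval w = ∏ j ∈ Finset.range n, (w + j) := by
  induction n with
  | zero => simp
  | succ n ih => rw [ascPochhammer_succ_eval, ih, Finset.prod_range_succ]

lemma binom (w : ℂ) (x : ℂ) (hx : ‖x‖ < 1) :
    HasSum (fun n : ℕ => (∏ j ∈ Finset.range n, (w + j)) * (-x) ^ n / (n.factorial : ℂ)) ((1 + x) ^ (-w)) := by
  have := (Complex.one_div_one_sub_cpow_hasFPowerSeriesOnBall_zero w).hasSum (y := -x) (by
    simpa [enorm_eq_nnnorm, ← NNReal.coe_lt_coe] using hx)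
  simp only [zero_add, sub_neg_eq_add, one_div, ← Complex.cpow_neg] at this
  convert! this using 2 with n
  have e : Ring.choose (w + n - 1) n = (∏ j ∈ Finset.range n, (w + j)) / (n.factorial : ℂ) := by
    rw [eq_div_iff (by exact_mod_cast n.factorial_ne_zero), mul_comm, ← nsmul_eq_mul, Ring.choose, Ring.factorial_nsmul_multichoose_eq_ascPochhammer, Polynomial.ascPochhammer_smeval_eq_eval, asc_prod]
    apply Finset.prod_congr rfl; intros; ring
  simp [e]
  ring

def U : Set ℂ := {s | ∀ m : ℤ, m ≤ 1 → s ≠ (m : ℂ)}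

lemma U_eq : U = (((fun m : ℤ => (m : ℂ)) '' {m | m ≤ 1}))ᶜ := by
  ext s; simp only [U, Set.mem_ofPred_eq, Set.mem_compl_iff, Set.mem_image, not_exists, not_and]
  exact forall₂_congr fun m _ => ne_comm

lemma U_open : IsOpen U := by
  rw [U_eq, isOpen_compl_iff]
  have : Topology.IsClosedEmbedding (fun m : ℤ => (m : ℂ)) := by
    have := Complex.isometry_ofReal.isClosedEmbedding.comp Int.isClosedEmbedding_coe_real
    convert this using 1
    ext; simp
  exact this.isClosedMap _ (isClosed_discrete _)

lemma U_conn : IsPreconnected U := by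
  rw [U_eq]
  exact (Set.Countable.isPathConnected_compl_of_one_lt_rank (by simp) ((Set.to_countable _).image _)).isConnected.isPreconnected

lemma c_diff (n k : ℕ) : DifferentiableOn ℂ (c n k) U := by
  intro w hw
  apply DifferentiableAt.differentiableWithinAt
  unfold c zetaK
  have h1 : w + n ≠ 1 := by
    intro h
    apply hw (1 - n) (by omega)
    push_cast; rw [← h]; ring
  have h2 : DifferentiableAt ℂ (fun s => riemannZeta (s + n)) w :=
    DifferentiableAt.comp w (differentiableAt_riemannZeta h1) (by fun_prop)
  refine DifferentiableAt.fun_mul (by fun_prop) (h2.fun_sub (DifferentiableAt.fun_sum fun m hm => ?_))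
  have : (m : ℂ) ≠ 0 := by
    have := (Finset.mem_Ico.1 hm).1
    exact_mod_cast (by omega)
  exact DifferentiableAt.const_cpow (by fun_prop) (Or.inl this)

lemma zetaK_hasSum (k : ℕ) (hk : 1 ≤ k) (s : ℂ) (hs : 1 < s.re) :
    HasSum (fun m : ℕ => ((m + k : ℕ) : ℂ) ^ (-s)) (zetaK k s) := by
  have h1 : HasSum (fun m : ℕ => (m : ℂ) ^ (-s)) (riemannZeta s) := by
    have := (Complex.summable_one_div_nat_cpow.2 hs).hasSum
    rw [← zeta_eq_tsum_one_div_nat_cpow hs] at this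
    simpa [Complex.cpow_neg] using this
  rw [hasSum_nat_add_iff (f := fun m : ℕ => (m : ℂ) ^ (-s)), zetaK]
  convert! h1 using 1
  have h0 : s ≠ 0 := Complex.ne_zero_of_one_lt_re hs
  rw [Finset.range_eq_Ico, Finset.sum_eq_sum_Ico_succ_bot (a := 0) (b := k) (by omega)]
  simp [Complex.zero_cpow, h0]

lemma norm_nat (m : ℕ) (hm : 0 < m) (s : ℂ) : ‖(m : ℂ) ^ (-s)‖ = (m : ℝ) ^ (-s.re) := by
  rw [Complex.norm_natCast_cpow_of_pos hm]; simp

lemma prod_sum (R : ℕ) (α : ℝ) (hα0 : 0 < α) (hα1 : α < 1) :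
    Summable (fun n : ℕ => (∏ j ∈ Finset.range n, ((R : ℝ) + j)) * α ^ n / n.factorial) := by
  have := (binom R (-α) (by simpa [abs_of_pos hα0] using hα1)).summable
  simp only [neg_neg] at this
  rw [← Complex.summable_ofReal]
  convert this using 2
  push_cast; rfl

lemma prod_bd (R : ℕ) (w : ℂ) (hw : ‖w‖ ≤ R) (n : ℕ) :
    ‖∏ j ∈ Finset.range n, (w + j)‖ ≤ ∏ j ∈ Finset.range n, ((R : ℝ) + j) := by
  rw [norm_prod]
  refine Finset.prod_le_prod (fun _ _ => norm_nonneg _) fun j _ => ?_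
  exact (norm_add_le _ _).trans (by simpa using hw)

lemma zetaK_bd (k : ℕ) (hk : 1 ≤ k) : ∃ C : ℝ, ∀ s : ℂ, 2 ≤ s.re → ‖zetaK k s‖ ≤ C := by
  have hS : Summable (fun m : ℕ => ((m + k : ℕ) : ℝ) ^ (-2 : ℝ)) :=
    (summable_nat_add_iff k).2 (Real.summable_nat_rpow.2 (by norm_num))
  refine ⟨∑' m : ℕ, ((m + k : ℕ) : ℝ) ^ (-2 : ℝ), fun s hs => ?_⟩
  rw [← (zetaK_hasSum k hk s (by linarith)).tsum_eq]
  refine tsum_of_norm_bounded hS.hasSum fun m => ?_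
  rw [norm_nat _ (by omega)]
  exact Real.rpow_le_rpow_of_exponent_le (by exact_mod_cast (by omega)) (by linarith)

lemma series_conv (k : ℕ) (hk : 1 ≤ k) (α : ℝ) (hα0 : 0 < α) (hα1 : α < 1) :
    TendstoLocallyUniformlyOn
      (fun (t : Finset ℕ) x => ∑ n ∈ t, c n k x * ((-(α : ℂ)) ^ n / (n.factorial : ℂ)))
      (fun x => ∑' n, c n k x * ((-(α : ℂ)) ^ n / (n.factorial : ℂ))) atTop U := by
  rw [tendstoLocallyUniformlyOn_iff_forall_isCompact U_open]
  intro K hK hKc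
  obtain ⟨C, hC⟩ := zetaK_bd k hk
  obtain ⟨R', hR'⟩ := hKc.isBounded.exists_norm_le
  obtain ⟨R, hR⟩ := exists_nat_ge R'
  refine tendstoUniformlyOn_tsum_of_cofinite_eventually ((prod_sum R α hα0 hα1).mul_right C) ?_
  rw [Nat.cofinite_eq_atTop]
  filter_upwards [eventually_ge_atTop (R + 2)] with n hn x hx
  have hxR : ‖x‖ ≤ R := (hR' x hx).trans hR
  have h2 : 2 ≤ (x + n).re := by
    have := (abs_le.1 ((Complex.abs_re_le_norm x).trans hxR)).1
    have : ((R + 2 : ℕ) : ℝ) ≤ n := by exact_mod_cast hn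
    push_cast at this
    simp; linarith
  have h3 := hC _ h2
  have h4 := prod_bd R x hxR n
  have : ‖c n k x * ((-(α : ℂ)) ^ n / (n.factorial : ℂ))‖ =
      (‖∏ j ∈ Finset.range n, (x + j)‖ * α ^ n / n.factorial) * ‖zetaK k (x + n)‖ := by
    rw [c]; simp [abs_of_pos hα0]; ring
  rw [this]
  have := norm_nonneg (zetaK k (x + n))
  gcongr

lemma shift_cpow (k m : ℕ) (hk : 1 ≤ k) (α : ℝ) (hα0 : 0 < α) (hα1 : α < 1) (w : ℂ) :
    HasSum (fun n : ℕ => (∏ j ∈ Finset.range n, (w + j)) * ((m + k : ℕ) : ℂ) ^ (-(w + n)) *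
      ((-(α : ℂ)) ^ n / (n.factorial : ℂ))) ((((m + k : ℕ) : ℂ) + α) ^ (-w)) := by
  have hM : 1 ≤ m + k := by omega
  generalize m + k = M at *
  have hM' : (1 : ℝ) ≤ M := by exact_mod_cast hM
  have hM0 : (M : ℂ) ≠ 0 := by exact_mod_cast (by omega)
  have h := (binom w ((α / M : ℝ) : ℂ) (by
    rw [Complex.norm_real, Real.norm_of_nonneg (by positivity), div_lt_one (by positivity)]
    linarith)).mul_left ((M : ℂ) ^ (-w))
  convert! h using 1
  · ext n
    rw [neg_add, Complex.cpow_add _ _ hM0, Complex.cpow_neg _ (n : ℂ), Complex.cpow_natCast]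
    push_cast
    rw [← neg_div, div_pow]
    field_simp
  · have e1 : (M : ℂ) + α = ((M : ℝ) : ℂ) * ((1 + α / M : ℝ) : ℂ) := by
      push_cast; field_simp
    rw [e1, Complex.mul_cpow_ofReal_nonneg (by positivity) (by positivity)]
    simp

lemma series_val (k : ℕ) (hk : 1 ≤ k) (α : ℝ) (hα0 : 0 < α) (hα1 : α < 1) (w : ℂ) (hw : 1 < w.re) :
    HurwitzZeta.hurwitzZeta (α : UnitAddCircle) w =
      ∑ n ∈ Finset.range k, ((((n : ℝ) + α : ℝ) : ℂ)) ^ (-w) +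
      ∑' n, c n k w * ((-(α : ℂ)) ^ n / (n.factorial : ℂ)) := by
  have h1 : HasSum (fun n : ℕ => (((n : ℝ) + α : ℝ) : ℂ) ^ (-w)) (HurwitzZeta.hurwitzZeta (α : UnitAddCircle) w) := by
    have := HurwitzZeta.hasSum_hurwitzZeta_of_one_lt_re (a := α) ⟨hα0.le, hα1.le⟩ hw
    simpa [Complex.cpow_neg] using this
  rw [← h1.tsum_eq, ← h1.summable.sum_add_tsum_nat_add k]
  congr 1
  have h2 : ∀ m : ℕ, (((((m + k : ℕ) : ℝ) + α : ℝ) : ℂ)) ^ (-w) = ∑' n : ℕ, (∏ j ∈ Finset.range n, (w + j)) * ((m + k : ℕ) : ℂ) ^ (-(w + n)) *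
      ((-(α : ℂ)) ^ n / (n.factorial : ℂ)) := fun m => by
    rw [(shift_cpow k m hk α hα0 hα1 w).tsum_eq]; push_cast; rfl
  simp_rw [h2]
  obtain ⟨R, hR⟩ := exists_nat_ge ‖w‖
  have hS : Summable (fun m : ℕ => ((m + k : ℕ) : ℝ) ^ (-w.re)) :=
    (summable_nat_add_iff k).2 (Real.summable_nat_rpow.2 (by linarith))
  have hP := hS.mul_of_nonneg (prod_sum R α hα0 hα1) (fun m => by positivity) (fun m => by positivity)
  rw [← Summable.tsum_comm (f := fun m n : ℕ => (∏ j ∈ Finset.range n, (w + j)) *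
    ((m + k : ℕ) : ℂ) ^ (-(w + n)) * ((-(α : ℂ)) ^ n / (n.factorial : ℂ)))]
  · congr 1; ext n
    rw [tsum_mul_right, tsum_mul_left, (zetaK_hasSum k hk (w + n) (by
      have : (0:ℝ) ≤ n := by positivity
      simp; linarith)).tsum_eq, c]
  · refine Summable.of_norm_bounded hP ?_
    rintro ⟨m, n⟩
    simp only [Function.uncurry]
    rw [norm_mul, norm_mul, norm_nat _ (by omega)]
    have h4 := prod_bd R w hR n
    have h5 : ((m + k : ℕ) : ℝ) ^ (-(w + n).re) ≤ ((m + k : ℕ) : ℝ) ^ (-w.re) :=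
      Real.rpow_le_rpow_of_exponent_le (by exact_mod_cast (by omega)) (by simp)
    have h6 : ‖(-(α : ℂ)) ^ n / (n.factorial : ℂ)‖ = α ^ n / n.factorial := by
      simp [abs_of_pos hα0]
    rw [h6]
    calc _ ≤ (∏ j ∈ Finset.range n, ((R : ℝ) + j)) * ((m + k : ℕ) : ℝ) ^ (-w.re) * (α ^ n / n.factorial) := by
          gcongr
      _ = _ := by ring

theorem stmt_6 (k : ℕ) (hk : 1 ≤ k) (r : ℕ) (hr : 1 ≤ r)
    (α : ℝ) (hα0 : 0 < α) (hα1 : α < 1)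
    (s : ℂ) (hs : ∀ m : ℤ, m ≤ 1 → s ≠ (m : ℂ)) :
    Summable (fun n : ℕ =>
      iteratedDeriv r (fun w => c n k w) s * (-(α : ℂ)) ^ n / (n.factorial : ℂ)) ∧
    iteratedDeriv r (fun w => HurwitzZeta.hurwitzZeta (α : UnitAddCircle) w) s
      = ∑ n ∈ Finset.range k,
          (-1) ^ r * ((n : ℂ) + α) ^ (-s) * ((Real.log ((n : ℝ) + α) : ℂ)) ^ r
        + ∑' n : ℕ,
            iteratedDeriv r (fun w => c n k w) s * (-(α : ℂ)) ^ n / (n.factorial : ℂ) := by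
  have hsU : s ∈ U := hs
  have hconv := series_conv k hk α hα0 hα1
  have hcd : ∀ n, DifferentiableOn ℂ (fun x => c n k x * ((-(α : ℂ)) ^ n / (n.factorial : ℂ))) U :=
    fun n => (c_diff n k).mul_const _
  obtain ⟨-, hd0, -⟩ := hs_deriv U_open hcd hconv 0
  rw [iteratedDeriv_zero] at hd0
  obtain ⟨-, -, h3⟩ := hs_deriv U_open hcd hconv r
  have hsum : HasSum _ _ := h3.tendsto_at hsU
  have e : ∀ n, iteratedDeriv r (fun x => c n k x * ((-(α : ℂ)) ^ n / (n.factorial : ℂ))) s =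
      iteratedDeriv r (fun w => c n k w) s * (-(α : ℂ)) ^ n / (n.factorial : ℂ) := by
    intro n
    rw [iteratedDeriv_mul_const_field, mul_div_assoc]
  simp_rw [e] at hsum
  refine ⟨hsum.summable, ?_⟩
  have hpd : ∀ n : ℕ, Differentiable ℂ (fun w : ℂ => (((n : ℝ) + α : ℝ) : ℂ) ^ (-w)) := fun n w => by
    have : (((n : ℝ) + α : ℝ) : ℂ) ≠ 0 := by
      exact_mod_cast (by positivity : (n : ℝ) + α ≠ 0)
    exact DifferentiableAt.const_cpow (by fun_prop) (Or.inl this)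
  have hEq : Set.EqOn (fun w => HurwitzZeta.hurwitzZeta (α : UnitAddCircle) w)
      (fun w => ∑ n ∈ Finset.range k, ((((n : ℝ) + α : ℝ) : ℂ)) ^ (-w) +
      ∑' n, c n k w * ((-(α : ℂ)) ^ n / (n.factorial : ℂ))) U := by
    refine AnalyticOnNhd.eqOn_of_preconnected_of_eventuallyEq (z₀ := 2)
      (DifferentiableOn.analyticOnNhd (fun w hw => ?_) U_open)
      (DifferentiableOn.analyticOnNhd (DifferentiableOn.fun_add ?_ hd0) U_open) U_conn ?_ ?_
    · exact (HurwitzZeta.differentiableAt_hurwitzZeta _ (by simpa using hw 1 le_rfl)).differentiableWithinAt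
    · exact DifferentiableOn.fun_sum fun n _ => (hpd n).differentiableOn
    · intro m hm h
      have : (2 : ℤ) = m := by exact_mod_cast h
      omega
    · filter_upwards [(isOpen_lt continuous_const Complex.continuous_re).mem_nhds
        (show (1 : ℝ) < (2 : ℂ).re by norm_num)] with w hw
      exact series_val k hk α hα0 hα1 w hw
  rw [(hEq.eventuallyEq_of_mem (U_open.mem_nhds hsU)).iteratedDeriv_eq r, hsum.tsum_eq]
  have hpc : ∀ n : ℕ, ContDiffAt ℂ r (fun w : ℂ => (((n : ℝ) + α : ℝ) : ℂ) ^ (-w)) s :=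
    fun n => (hpd n).contDiff.contDiffAt
  rw [iteratedDeriv_fun_add (ContDiffAt.sum fun n _ => hpc n)
    ((hd0.analyticAt (U_open.mem_nhds hsU)).contDiffAt)]
  congr 1
  rw [iteratedDeriv_fun_sum fun n _ => hpc n]
  refine Finset.sum_congr rfl fun n _ => ?_
  rw [iter_cpow _ (by positivity)]
  push_cast; rfl
end

section
/- Let α be a real number with 0 < α < 1 and let s be a complex number with s ≠ 0 and s ≠ 1. Then the function x ↦ ζ(s,x) of the real variable x has derivative −s·ζ(s+1,α) at x = α; i.e. HasDerivAt (fun x : ℝ => ζ(s,x)) (−s·ζ(s+1,α)) α. -/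
open Set Filter Topology MeasureTheory HurwitzZeta

/-- parametric integral: joint continuity -/
lemma aux_cont {X : Type*} [TopologicalSpace X] [FirstCountableTopology X] {F : X → ℝ → ℂ} {U : Set X}
    (hF : ContinuousOn (fun p : X × ℝ => F p.1 p.2) (U ×ˢ Icc 0 1)) :
    ContinuousOn (fun x => ∫ u in (0:ℝ)..1, F x u) U := by
  rw [continuousOn_iff_continuous_domRestrict]
  have h1 : Continuous (fun p : U × ℝ => F p.1 (projIcc (0:ℝ) 1 zero_le_one p.2)) := by
    refine hF.comp_continuous (f := fun p : U × ℝ => ((p.1 : X), ((projIcc (0:ℝ) 1 zero_le_one p.2 : Icc (0:ℝ) 1) : ℝ))) ?_ ?_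
    · exact (continuous_subtype_val.comp continuous_fst).prodMk
        (continuous_subtype_val.comp (continuous_projIcc.comp continuous_snd))
    · intro p
      exact ⟨p.1.2, (projIcc (0:ℝ) 1 zero_le_one p.2).2⟩
  have h2 := intervalIntegral.continuous_parametric_intervalIntegral_of_continuous'
    (μ := volume) (f := fun (x : U) (u : ℝ) => F x (projIcc (0:ℝ) 1 zero_le_one u)) h1 0 1
  convert h2 using 1
  ext x
  refine intervalIntegral.integral_congr fun u hu => ?_
  rw [uIcc_of_le zero_le_one] at hu
  simp [projIcc_of_mem _ hu]

lemma aux_diff_s7 {F : ℂ → ℝ → ℂ} {U : Set ℂ} (hU : IsOpen U)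
    (hF : ContinuousOn (fun p : ℂ × ℝ => F p.1 p.2) (U ×ˢ Icc 0 1))
    (hd : ∀ u ∈ Icc (0:ℝ) 1, DifferentiableOn ℂ (fun s => F s u) U) :
    DifferentiableOn ℂ (fun s => ∫ u in (0:ℝ)..1, F s u) U := by
  intro s₀ hs₀
  obtain ⟨ε, hε, hball⟩ := Metric.isOpen_iff.1 hU s₀ hs₀
  have hsub : Metric.closedBall s₀ (ε/2) ⊆ U :=
    (Metric.closedBall_subset_ball (by linarith)).trans hball
  obtain ⟨C, hC⟩ := ((isCompact_closedBall s₀ (ε/2)).prod (isCompact_Icc (a := (0:ℝ)) (b := 1))).exists_bound_of_continuousOn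
    (hF.mono (prod_mono hsub subset_rfl))
  have hcu : ∀ s ∈ U, ContinuousOn (F s) (Icc 0 1) := fun s hs =>
    hF.comp (f := fun u : ℝ => (s, u)) (by fun_prop) (fun u hu => ⟨hs, hu⟩)
  have hIoc : (uIoc (0:ℝ) 1) ⊆ Icc 0 1 := by
    rw [uIoc_of_le zero_le_one]; exact Ioc_subset_Icc_self
  have hm : ∀ s ∈ U, AEStronglyMeasurable (F s) (volume.restrict (uIoc (0:ℝ) 1)) := fun s hs =>
    ((hcu s hs).mono hIoc).aestronglyMeasurable measurableSet_uIoc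
  have hder : ∀ u ∈ Icc (0:ℝ) 1, ∀ s ∈ U, HasDerivAt (fun s => F s u) (deriv (fun s => F s u) s) s :=
    fun u hu s hs => ((hd u hu).differentiableAt (hU.mem_nhds hs)).hasDerivAt
  have key := intervalIntegral.hasDerivAt_integral_of_dominated_loc_of_deriv_le
    (μ := volume) (a := 0) (b := 1) (F := F) (F' := fun s u => deriv (fun s => F s u) s) (x₀ := s₀)
    (s := Metric.ball s₀ (ε/4)) (bound := fun _ => C / (ε/4)) (Metric.ball_mem_nhds _ (by linarith))
    (by filter_upwards [hU.mem_nhds hs₀] with s hs using hm s hs)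
    (by
      apply ContinuousOn.intervalIntegrable
      rw [uIcc_of_le zero_le_one]; exact hcu s₀ hs₀)
    ?_ ?_ (by simp) ?_
  · exact key.2.differentiableAt.differentiableWithinAt
  · let h : ℕ → ℂ := fun n => s₀ + ((ε/4/(n+1) : ℝ) : ℂ)
    have hh : ∀ n, h n ∈ U := fun n => hball (by
      simp only [h, Metric.mem_ball, dist_self_add_left]
      rw [Complex.norm_real, Real.norm_of_nonneg (by positivity)]
      rw [div_lt_iff₀ (by positivity)]
      have : (0:ℝ) ≤ n := n.cast_nonneg
      nlinarith)
    have hlim : Tendsto h atTop (𝓝[≠] s₀) := by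
      refine tendsto_nhdsWithin_iff.2 ⟨?_, Eventually.of_forall fun n => ?_⟩
      · have : Tendsto (fun n : ℕ => ε/4/((n:ℝ)+1)) atTop (𝓝 0) :=
          tendsto_const_div_atTop_nhds_zero_nat (ε/4) |>.comp (tendsto_add_atTop_nat 1) |>.congr (by
            intro n; simp)
        have h3 := (Complex.continuous_ofReal.tendsto 0).comp this
        have h4 := h3.const_add s₀
        simpa [h, Function.comp_def] using h4
      · have : (ε/4/((n:ℝ)+1)) ≠ 0 := by positivity
        simp only [h, mem_compl_iff, mem_singleton_iff, add_eq_left]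
        exact_mod_cast this
    refine aestronglyMeasurable_of_tendsto_ae atTop
      (f := fun n u => slope (fun s => F s u) s₀ (h n)) (fun n => ?_) ?_
    · simp only [slope_def_field]
      simp_rw [div_eq_mul_inv]
      exact ((hm _ (hh n)).sub (hm _ hs₀)).mul_const _
    · refine (ae_restrict_iff' measurableSet_uIoc).2 (Eventually.of_forall fun u hu => ?_)
      exact ((hder u (hIoc hu) s₀ hs₀).tendsto_slope).comp hlim
  · refine Eventually.of_forall fun u hu s hs => ?_
    have hsb : Metric.closedBall s (ε/4) ⊆ Metric.closedBall s₀ (ε/2) := by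
      refine Metric.closedBall_subset_closedBall' ?_
      rw [Metric.mem_ball] at hs; linarith
    refine Complex.norm_deriv_le_of_forall_mem_sphere_norm_le (by linarith) ?_ ?_
    · refine DifferentiableOn.diffContOnCl ?_
      refine (hd u (hIoc hu)).mono ?_
      exact (Metric.closure_ball_subset_closedBall.trans hsb).trans hsub
    · intro z hz
      exact hC (z, u) ⟨hsb (Metric.sphere_subset_closedBall hz), hIoc hu⟩
  · refine Eventually.of_forall fun u hu s hs => hder u (hIoc hu) s (hball ?_)
    exact Metric.ball_subset_ball (by linarith) hs

lemma aux_tail {t : ℝ} (ht : t ∈ Ioo (0:ℝ) 1) {s : ℂ} (hs : 1 < s.re) :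
    hurwitzZeta t s = (t:ℂ) ^ (-s) + ∑' n : ℕ, (((n:ℝ) + 1 + t : ℝ) : ℂ) ^ (-s) := by
  have h := hasSum_hurwitzZeta_of_one_lt_re ⟨ht.1.le, ht.2.le⟩ hs
  rw [← h.tsum_eq, h.summable.tsum_eq_zero_add]
  simp [Complex.cpow_neg]

lemma aux_norm_s7 {t : ℝ} (ht : t ∈ Ioo (0:ℝ) 1) {s : ℂ} {σ : ℝ} (h0 : 0 ≤ σ) (hs : σ ≤ s.re) (n : ℕ) :
    ‖(((n:ℝ) + 1 + t : ℝ) : ℂ) ^ (-s)‖ ≤ 1 / ((n:ℝ) + 1) ^ σ := by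
  have hn : (0:ℝ) ≤ n := n.cast_nonneg
  rw [Complex.norm_cpow_eq_rpow_re_of_pos (by linarith [ht.1]), Complex.neg_re,
    Real.rpow_neg (by linarith [ht.1]), ← one_div]
  refine one_div_le_one_div_of_le (by positivity) ?_
  calc ((n:ℝ)+1) ^ σ ≤ ((n:ℝ)+1) ^ s.re := Real.rpow_le_rpow_of_exponent_le (by linarith) hs
    _ ≤ _ := Real.rpow_le_rpow (by positivity) (by linarith [ht.1]) (by linarith)

lemma aux_summ {σ : ℝ} (h : 1 < σ) : Summable fun n : ℕ => 1 / ((n:ℝ) + 1) ^ σ := by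
  have := (summable_nat_add_iff 1).2 (Real.summable_one_div_nat_rpow.2 h)
  simpa using this

lemma aux_cont_base : ContinuousOn (fun p : ℂ × ℝ => hurwitzZeta p.2 p.1)
    ({s : ℂ | 1 < s.re} ×ˢ Ioo 0 1) := by
  rintro ⟨s₀, t₀⟩ ⟨hs₀ : 1 < s₀.re, ht₀⟩
  obtain ⟨σ, hσ1, hσ2⟩ := exists_between hs₀
  have hV : ContinuousOn (fun p : ℂ × ℝ => hurwitzZeta p.2 p.1)
    ({s : ℂ | σ < s.re} ×ˢ Ioo 0 1) := by
    have : ContinuousOn (fun p : ℂ × ℝ => (p.2:ℂ) ^ (-p.1) + ∑' n : ℕ, (((n:ℝ) + 1 + p.2 : ℝ) : ℂ) ^ (-p.1))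
      ({s : ℂ | σ < s.re} ×ˢ Ioo 0 1) := by
      refine ContinuousOn.add ?_ (continuousOn_tsum (fun n => ?_) (aux_summ hσ1) ?_)
      · refine ContinuousOn.cpow (by fun_prop) (by fun_prop) ?_
        rintro p ⟨-, hp⟩
        exact Complex.ofReal_mem_slitPlane.2 hp.1
      · refine ContinuousOn.cpow (by fun_prop) (by fun_prop) ?_
        rintro p ⟨-, hp⟩
        have hn : (0:ℝ) ≤ n := n.cast_nonneg
        exact Complex.ofReal_mem_slitPlane.2 (by linarith [hp.1])
      · rintro n p ⟨hp1, hp⟩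
        exact aux_norm_s7 hp (by linarith) (le_of_lt hp1) n
    refine this.congr ?_
    rintro p ⟨hp1, hp⟩
    exact aux_tail hp (hσ1.trans hp1)
  refine (hV.continuousAt ?_).continuousWithinAt
  refine prod_mem_nhds ?_ (Ioo_mem_nhds ht₀.1 ht₀.2)
  exact (isOpen_lt continuous_const Complex.continuous_re).mem_nhds hσ2

lemma aux_deriv_base {t : ℝ} (ht : t ∈ Ioo (0:ℝ) 1) {s : ℂ} (hs : 1 < s.re) :
    HasDerivAt (fun x : ℝ => hurwitzZeta x s) (-s * hurwitzZeta t (s+1)) t := by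
  have hs0 : -s ≠ 0 := by
    intro h
    have : s = 0 := by simpa using h
    simp [this] at hs; linarith
  have hs' : 1 < (s+1).re := by simp; linarith
  have e : -s - 1 = -(s+1) := by ring
  have hn : ∀ n : ℕ, (0:ℝ) ≤ n := fun n => n.cast_nonneg
  have hbase : ∀ x : ℝ, 0 < x → HasDerivAt (fun y : ℝ => (y:ℂ) ^ (-s)) (-s * (x:ℂ) ^ (-(s+1))) x := by
    intro x hx
    simpa [e] using hasDerivAt_ofReal_cpow_const hx.ne' hs0
  have h2 := hasDerivAt_tsum_of_isPreconnected (u := fun n : ℕ => ‖s‖ * (1 / ((n:ℝ) + 1) ^ (s+1).re))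
    (t := Ioo (0:ℝ) 1) (g := fun (n:ℕ) (x:ℝ) => (((n:ℝ) + 1 + x : ℝ) : ℂ) ^ (-s))
    (g' := fun (n:ℕ) (x:ℝ) => -s * (((n:ℝ) + 1 + x : ℝ) : ℂ) ^ (-(s+1))) (y₀ := t) (y := t)
    ((aux_summ hs').mul_left _) isOpen_Ioo isPreconnected_Ioo ?_ ?_ ht ?_ ht
  · have h3 := (hbase t ht.1).add h2
    have h4 : -s * hurwitzZeta t (s+1) = -s * (t:ℂ) ^ (-(s+1)) +
        ∑' n : ℕ, -s * (((n:ℝ) + 1 + t : ℝ) : ℂ) ^ (-(s+1)) := by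
      rw [aux_tail ht hs', tsum_mul_left, mul_add]
    rw [h4]
    refine h3.congr_of_eventuallyEq ?_
    filter_upwards [Ioo_mem_nhds ht.1 ht.2] with x hx
    exact aux_tail hx hs
  · intro n x hx
    exact (hbase ((n:ℝ)+1+x) (by linarith [hx.1, hn n])).comp_const_add ((n:ℝ)+1) x
  · intro n x hx
    rw [norm_mul, norm_neg]
    gcongr
    exact aux_norm_s7 hx (by linarith) le_rfl n
  · exact Summable.of_norm_bounded (aux_summ hs) (fun n => aux_norm_s7 ht (by linarith) le_rfl n)

noncomputable def auxR (s : ℂ) (t : ℝ) : ℂ := hurwitzZeta t s - hurwitzZeta ((1/2 : ℝ) : UnitAddCircle) s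

noncomputable def auxC : ℂ → ℂ :=
  Function.update (fun s => s * hurwitzZeta ((1/2 : ℝ) : UnitAddCircle) (s+1)) 0 1

lemma auxC_ne {s : ℂ} (hs : s ≠ 0) : auxC s = s * hurwitzZeta ((1/2 : ℝ) : UnitAddCircle) (s+1) := by
  simp [auxC, hs]

lemma auxC_diff : Differentiable ℂ auxC := by
  rw [← differentiableOn_univ]
  refine (Complex.differentiableOn_compl_singleton_and_continuousAt_iff (c := 0) univ_mem).1 ⟨?_, ?_⟩
  · intro s hs
    have hs : s ≠ 0 := by simpa using hs
    have : DifferentiableAt ℂ (fun s => s * hurwitzZeta ((1/2 : ℝ) : UnitAddCircle) (s+1)) s := by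
      refine differentiableAt_id.mul ?_
      exact (differentiableAt_hurwitzZeta _ (by simpa using hs)).comp s (by fun_prop : DifferentiableAt ℂ (fun s : ℂ => s + 1) s)
    refine (this.congr_of_eventuallyEq ?_).differentiableWithinAt
    filter_upwards [isOpen_ne.mem_nhds hs] with z hz using auxC_ne hz
  · rw [auxC, continuousAt_update_same]
    have h := hurwitzZeta_residue_one ((1/2 : ℝ) : UnitAddCircle)
    have h1 : Tendsto (fun s : ℂ => s + 1) (𝓝[≠] 0) (𝓝[≠] 1) := by
      refine tendsto_nhdsWithin_iff.2 ⟨?_, ?_⟩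
      · have : Tendsto (fun s : ℂ => s + 1) (𝓝 0) (𝓝 (0+1)) := (by fun_prop : Continuous fun s : ℂ => s + 1).tendsto 0
        rw [zero_add] at this
        exact this.mono_left nhdsWithin_le_nhds
      · filter_upwards [self_mem_nhdsWithin] with z hz
        simpa using hz
    simpa [Function.comp_def] using h.comp h1

lemma auxR_diff (t : ℝ) : Differentiable ℂ (fun s => auxR s t) :=
  differentiable_hurwitzZeta_sub_hurwitzZeta _ _

lemma aux_seg {y u : ℝ} (hy : y ∈ Ioo (0:ℝ) 1) (hu : u ∈ Icc (0:ℝ) 1) :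
    1/2 + (y - 1/2) * u ∈ Ioo (0:ℝ) 1 := by
  obtain ⟨h1, h2⟩ := hy
  obtain ⟨h3, h4⟩ := hu
  constructor <;> nlinarith [mul_nonneg h1.le h3, mul_nonneg (sub_nonneg.2 h2.le) h3]

/-- the right-hand side of the integral identity -/
noncomputable def auxE (s : ℂ) (y : ℝ) : ℂ :=
  ((y - 1/2 : ℝ) : ℂ) * (-s * (∫ u in (0:ℝ)..1, auxR (s+1) (1/2 + (y - 1/2) * u)) - auxC s)

def auxP (N : ℕ) : Prop :=
  ContinuousOn (fun p : ℂ × ℝ => auxR p.1 p.2) ({s : ℂ | 1 - (N:ℝ) < s.re} ×ˢ Ioo 0 1)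

lemma auxP_zero : auxP 0 := by
  have h := aux_cont_base
  have h2 : ContinuousOn (fun p : ℂ × ℝ => hurwitzZeta ((1/2 : ℝ) : UnitAddCircle) p.1)
    ({s : ℂ | 1 < s.re} ×ˢ Ioo 0 1) := 
    h.comp (f := fun p : ℂ × ℝ => (p.1, (1/2 : ℝ))) (by fun_prop) (by
      rintro p ⟨hp, -⟩
      exact ⟨hp, by norm_num⟩)
  have h3 := h.sub h2
  unfold auxP
  rw [Nat.cast_zero, sub_zero]
  exact h3

lemma auxE_base {s : ℂ} (hs : 1 < s.re) {y : ℝ} (hy : y ∈ Ioo (0:ℝ) 1) : auxR s y = auxE s y := by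
  have hs' : 1 < (s+1).re := by simp; linarith
  have hs0 : s ≠ 0 := by rintro rfl; simp at hs; linarith
  have hc : ContinuousOn (fun u : ℝ => auxR (s+1) (1/2 + (y - 1/2) * u)) (Icc 0 1) :=
    auxP_zero.comp (f := fun u : ℝ => (s+1, 1/2 + (y-1/2)*u)) (by fun_prop)
      (fun u hu => ⟨by simpa using hs', aux_seg hy hu⟩)
  have hi : IntervalIntegrable (fun u : ℝ => auxR (s+1) (1/2 + (y - 1/2) * u)) volume 0 1 := by
    apply ContinuousOn.intervalIntegrable
    rwa [uIcc_of_le zero_le_one]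
  have key := intervalIntegral.integral_eq_sub_of_hasDerivAt (a := 0) (b := 1)
    (f := fun u : ℝ => auxR s (1/2 + (y - 1/2) * u))
    (f' := fun u : ℝ => ((y - 1/2 : ℝ) : ℂ) * (-s * auxR (s+1) (1/2 + (y - 1/2) * u) - auxC s)) ?_ ?_
  · rw [intervalIntegral.integral_const_mul, intervalIntegral.integral_sub (hi.const_mul _) (by simp),
      intervalIntegral.integral_const_mul] at key
    simp only [intervalIntegral.integral_const] at key
    rw [auxE]
    simp only [mul_one, mul_zero, add_zero, sub_zero, one_smul] at key
    rw [key]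
    simp [auxR]
  · intro u hu
    rw [uIcc_of_le zero_le_one] at hu
    have h1 := (aux_deriv_base (aux_seg hy hu) hs).sub_const (hurwitzZeta ((1/2 : ℝ) : UnitAddCircle) s)
    have h2 : HasDerivAt (fun u : ℝ => 1/2 + (y - 1/2) * u) (y - 1/2) u := by
      simpa using ((hasDerivAt_id u).const_mul (y - 1/2)).const_add (1/2)
    have h3 := h1.scomp u h2
    refine HasDerivAt.congr_deriv (f := fun u : ℝ => auxR s (1/2 + (y - 1/2) * u)) h3 ?_
    rw [auxC_ne hs0, auxR, Complex.real_smul]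
    ring
  · exact ((hi.const_mul _).sub (by simp)).const_mul _

lemma aux_cont2 {N : ℕ} (h : auxP N) : ContinuousOn (fun q : (ℂ × ℝ) × ℝ => auxR (q.1.1+1) (1/2 + (q.1.2 - 1/2) * q.2))
    (({s : ℂ | 1 - ((N+1 : ℕ):ℝ) < s.re} ×ˢ Ioo 0 1) ×ˢ Icc 0 1) := by
  refine ContinuousOn.comp (g := fun p : ℂ × ℝ => auxR p.1 p.2)
    (f := fun q : (ℂ × ℝ) × ℝ => (q.1.1+1, 1/2 + (q.1.2 - 1/2) * q.2)) h (by fun_prop) ?_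
  rintro q ⟨⟨h1, h2⟩, h3⟩
  refine ⟨?_, aux_seg h2 h3⟩
  simp at h1 ⊢
  linarith

lemma auxE_eq {N : ℕ} (h : auxP N) {s : ℂ} (hs : 1 - ((N+1 : ℕ):ℝ) < s.re) {y : ℝ} (hy : y ∈ Ioo (0:ℝ) 1) :
    auxR s y = auxE s y := by
  have hU : IsOpen {s : ℂ | 1 - ((N+1 : ℕ):ℝ) < s.re} := isOpen_lt continuous_const Complex.continuous_re
  have hE : DifferentiableOn ℂ (fun s => auxE s y) {s : ℂ | 1 - ((N+1 : ℕ):ℝ) < s.re} := by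
    refine (differentiableOn_const _).mul ((differentiableOn_id.neg.mul ?_).sub auxC_diff.differentiableOn)
    refine aux_diff_s7 hU ?_ ?_
    · exact (aux_cont2 h).comp (f := fun p : ℂ × ℝ => ((p.1, y), p.2)) (by fun_prop)
        (fun p hp => ⟨⟨hp.1, hy⟩, hp.2⟩)
    · intro u hu
      exact ((auxR_diff _).comp (by fun_prop : Differentiable ℂ fun s : ℂ => s + 1)).differentiableOn
  refine ((auxR_diff y).differentiableOn.analyticOnNhd hU).eqOn_of_preconnected_of_eventuallyEq
    (hE.analyticOnNhd hU) (convex_halfSpace_re_gt _).isPreconnected (z₀ := 2) ?_ ?_ hs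
  · simp; linarith [(N.cast_nonneg : (0:ℝ) ≤ N)]
  · have : {s : ℂ | 1 < s.re} ∈ 𝓝 (2:ℂ) :=
      (isOpen_lt continuous_const Complex.continuous_re).mem_nhds (by simp)
    filter_upwards [this] with z hz using auxE_base hz hy

lemma auxP_all (N : ℕ) : auxP N := by
  induction N with
  | zero => exact auxP_zero
  | succ N ih =>
    have : ContinuousOn (fun p : ℂ × ℝ => auxE p.1 p.2) ({s : ℂ | 1 - ((N+1 : ℕ):ℝ) < s.re} ×ˢ Ioo 0 1) := by
      have h1 := aux_cont (F := fun (p : ℂ × ℝ) (u : ℝ) => auxR (p.1+1) (1/2 + (p.2 - 1/2) * u)) (aux_cont2 ih)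
      have h2 : Continuous fun p : ℂ × ℝ => auxC p.1 := auxC_diff.continuous.comp continuous_fst
      have h3 : Continuous fun p : ℂ × ℝ => ((p.2 - 1/2 : ℝ) : ℂ) := by fun_prop
      have h4 : Continuous fun p : ℂ × ℝ => -p.1 := by fun_prop
      exact h3.continuousOn.mul ((h4.continuousOn.mul h1).sub h2.continuousOn)
    exact this.congr fun p hp => auxE_eq ih hp.1 hp.2

theorem stmt_7 (α : ℝ) (hα0 : 0 < α) (hα1 : α < 1)
    (s : ℂ) (hs0 : s ≠ 0) (hs1 : s ≠ 1) :
    HasDerivAt (fun x : ℝ => HurwitzZeta.hurwitzZeta (x : UnitAddCircle) s)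
      (-s * HurwitzZeta.hurwitzZeta (α : UnitAddCircle) (s + 1)) α := by
  obtain ⟨N, hN⟩ := exists_nat_gt (-s.re)
  have hs : 1 - ((N+1 : ℕ):ℝ) < s.re := by push_cast; linarith
  have hcont : ContinuousOn (fun t : ℝ => auxR (s+1) t) (Ioo 0 1) :=
    (auxP_all N).comp (f := fun t : ℝ => (s+1, t)) (by fun_prop)
      (fun t ht => ⟨by simp; linarith, ht⟩)
  have hsub : uIcc (1/2) α ⊆ Ioo (0:ℝ) 1 :=
    ordConnected_Ioo.uIcc_subset (by norm_num) ⟨hα0, hα1⟩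
  have hd : HasDerivAt (fun y : ℝ => ∫ t in (1/2:ℝ)..y, auxR (s+1) t) (auxR (s+1) α) α :=
    intervalIntegral.integral_hasDerivAt_right (hcont.mono hsub).intervalIntegrable
      (hcont.stronglyMeasurableAtFilter isOpen_Ioo α ⟨hα0, hα1⟩)
      (hcont.continuousAt (Ioo_mem_nhds hα0 hα1))
  have h1 : HasDerivAt (fun y : ℝ => ((y - 1/2 : ℝ) : ℂ)) 1 α := by
    simpa using ((hasDerivAt_id α).sub_const (1/2)).ofReal_comp
  have h2 := ((hd.const_mul (-s)).sub (h1.mul_const (auxC s))).add_const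
    (hurwitzZeta ((1/2 : ℝ) : UnitAddCircle) s)
  have h3 : -s * auxR (s+1) α - 1 * auxC s = -s * hurwitzZeta (α : UnitAddCircle) (s + 1) := by
    rw [auxC_ne hs0, auxR]; ring
  rw [h3] at h2
  refine h2.congr_of_eventuallyEq ?_
  filter_upwards [Ioo_mem_nhds hα0 hα1] with y hy
  have h4 := auxE_eq (auxP_all N) hs hy
  have h5 := intervalIntegral.smul_integral_comp_add_mul (a := 0) (b := 1) (fun t => auxR (s+1) t) (y - 1/2) (1/2)
  rw [Complex.real_smul] at h5
  simp only [mul_zero, add_zero, mul_one, add_sub_cancel] at h5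
  rw [auxE] at h4
  simp only [Pi.sub_apply, ← h5]
  rw [auxR] at h4
  linear_combination h4
end

section
/- Let r₁ ≥ 0 and r₂ ≥ 0 be integers, let α be a real number with 0 < α < 1, and let s be a complex number with s ≠ 1 − j for every integer j with 0 ≤ j ≤ r₁. Then the mixed partial derivatives of the Hurwitz zeta function commute, in the explicit form: iteratedDeriv r₁ (fun x : ℝ => iteratedDeriv r₂ (fun w => ζ(w,x)) s) α = iteratedDeriv r₂ (fun w => (−1)^{r₁} · (∏_{j=0}^{r₁−1}(w+j)) · ζ(w+r₁, α)) s, where the right-hand side uses the identity ∂^{r₁}/∂α^{r₁} ζ(w,α) = (−1)^{r₁} w(w+1)⋯(w+r₁−1) ζ(w+r₁,α). -/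
open Set Filter Topology MeasureTheory
open scoped Interval

lemma hz_base_cont : ContinuousOn (fun p : ℂ × ℝ => HurwitzZeta.hurwitzZeta (p.2 : UnitAddCircle) p.1)
    ({s : ℂ | 1 < s.re} ×ˢ Ioo (0:ℝ) 1) := by
  have key : ∀ σ : ℝ, 1 < σ → ContinuousOn
      (fun p : ℂ × ℝ => ∑' n : ℕ, (((n + 1 + p.2 : ℝ)) : ℂ) ^ (-p.1))
      ({s : ℂ | σ < s.re} ×ˢ Ioo (0:ℝ) 1) := by
    intro σ hσ
    refine continuousOn_tsum (u := fun n : ℕ => ((n:ℝ) + 1) ^ (-σ)) ?_ ?_ ?_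
    · intro n p hp
      have hpos : 0 < (n + 1 + p.2 : ℝ) := by have := hp.2.1; positivity
      refine ContinuousAt.continuousWithinAt ?_
      refine ContinuousAt.cpow (by fun_prop) (by fun_prop) ?_
      exact Complex.ofReal_mem_slitPlane.2 hpos
    · have := (Real.summable_one_div_nat_add_rpow 1 σ).2 hσ
      refine this.congr fun n => ?_
      rw [abs_of_pos (by positivity), Real.rpow_neg (by positivity), one_div]
    · rintro n p ⟨hp1, hp2⟩
      have hpos : 0 < (n + 1 + p.2 : ℝ) := by have := hp2.1; positivity
      rw [Complex.norm_cpow_eq_rpow_re_of_pos hpos]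
      have h1 : (1:ℝ) ≤ n + 1 := by simp
      have h2 : (n:ℝ) + 1 ≤ n + 1 + p.2 := by linarith [hp2.1]
      have h3 : σ < p.1.re := hp1
      calc (n + 1 + p.2 : ℝ) ^ (-p.1).re ≤ (n + 1 + p.2 : ℝ) ^ (-σ) :=
            Real.rpow_le_rpow_of_exponent_le (h1.trans h2) (by simp; linarith)
        _ ≤ _ := Real.rpow_le_rpow_of_nonpos (by positivity) h2 (by linarith)
  rintro p ⟨hp1, hp2⟩
  obtain ⟨σ, h1, h2⟩ := exists_between (show 1 < p.1.re from hp1)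
  have hopen : ({s : ℂ | σ < s.re} ×ˢ Ioo (0:ℝ) 1) ∈ 𝓝 p :=
    ((isOpen_lt continuous_const Complex.continuous_re).prod isOpen_Ioo).mem_nhds ⟨h2, hp2⟩
  have hc := (key σ h1).continuousAt hopen
  have hc0 : ContinuousAt (fun p : ℂ × ℝ => (p.2 : ℂ) ^ (-p.1)) p :=
    ContinuousAt.cpow (by fun_prop) (by fun_prop) (Complex.ofReal_mem_slitPlane.2 hp2.1)
  refine ((hc0.add hc).congr ?_).continuousWithinAt
  filter_upwards [hopen] with q hq
  have hs := HurwitzZeta.hasSum_hurwitzZeta_of_one_lt_re (a := q.2) (Ioo_subset_Icc_self hq.2)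
    (s := q.1) (h1.trans hq.1)
  rw [← hs.tsum_eq, hs.summable.tsum_eq_zero_add]
  simp [Complex.cpow_neg]

lemma hz_base_deriv {s : ℂ} (hs : 1 < s.re) {x : ℝ} (hx : x ∈ Ioo (0:ℝ) 1) :
    HasDerivAt (fun x : ℝ => HurwitzZeta.hurwitzZeta (x : UnitAddCircle) s)
      (-s * HurwitzZeta.hurwitzZeta (x : UnitAddCircle) (s + 1)) x := by
  have hterm : ∀ (n : ℝ) (y : ℝ), 0 < n + y →
      HasDerivAt (fun y : ℝ => ((n + y : ℝ) : ℂ) ^ (-s)) (-s * ((n + y : ℝ) : ℂ) ^ (-(s + 1))) y := by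
    intro n y hy
    have := (((hasDerivAt_id (y:ℂ)).const_add (n:ℂ)).cpow_const (c := -s)
      (by simpa using Complex.ofReal_mem_slitPlane.2 hy)).comp_ofReal
    push_cast
    have he : -(s + 1) = -s - 1 := by ring
    rw [he]
    simpa only [id, mul_one] using this
  have hs1 : 1 < (s + 1).re := by simp; linarith
  have hsum : ∀ y ∈ Ioo (0:ℝ) 1, ∀ w : ℂ, 1 < w.re →
      HurwitzZeta.hurwitzZeta (y : UnitAddCircle) w =
        ((0 + y : ℝ) : ℂ) ^ (-w) + ∑' n : ℕ, (((n + 1 : ℝ) + y : ℝ) : ℂ) ^ (-w) := by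
    intro y hy w hw
    have hs := HurwitzZeta.hasSum_hurwitzZeta_of_one_lt_re (a := y) (Ioo_subset_Icc_self hy) hw
    rw [← hs.tsum_eq, hs.summable.tsum_eq_zero_add]
    simp [Complex.cpow_neg]
  have hsm : ∀ y ∈ Ioo (0:ℝ) 1, ∀ w : ℂ, 1 < w.re →
      Summable fun n : ℕ => (((n + 1 : ℝ) + y : ℝ) : ℂ) ^ (-w) := by
    intro y hy w hw
    have hs := HurwitzZeta.hasSum_hurwitzZeta_of_one_lt_re (a := y) (Ioo_subset_Icc_self hy) hw
    refine ((summable_nat_add_iff 1).2 hs.summable).congr fun n => ?_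
    simp [Complex.cpow_neg]
  have hmain := hasDerivAt_tsum_of_isPreconnected (𝕜 := ℝ)
    (u := fun n : ℕ => ‖s‖ * ((n:ℝ) + 1) ^ (-(s.re + 1)))
    (g := fun (n : ℕ) (y : ℝ) => (((n + 1 : ℝ) + y : ℝ) : ℂ) ^ (-s))
    (g' := fun (n : ℕ) (y : ℝ) => -s * (((n + 1 : ℝ) + y : ℝ) : ℂ) ^ (-(s + 1)))
    (t := Ioo (0:ℝ) 1) (y₀ := x) (y := x) ?_ isOpen_Ioo isPreconnected_Ioo ?_ ?_ hx (hsm x hx s hs) hx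
  · have h0 := (hterm 0 x (by simpa using hx.1)).add hmain
    rw [tsum_mul_left, ← mul_add, ← hsum x hx _ hs1] at h0
    refine h0.congr_of_eventuallyEq ?_
    filter_upwards [isOpen_Ioo.mem_nhds hx] with y hy
    exact hsum y hy s hs
  · refine Summable.mul_left _ ?_
    have := (Real.summable_one_div_nat_add_rpow 1 (s.re + 1)).2 (by linarith)
    refine this.congr fun n => ?_
    rw [abs_of_pos (by positivity), Real.rpow_neg (by positivity), one_div]
  · intro n y hy
    exact hterm _ y (by have := hy.1; positivity)
  · intro n y hy
    have hpos : 0 < ((n + 1 : ℝ) + y : ℝ) := by have := hy.1; positivity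
    rw [norm_mul, norm_neg, Complex.norm_cpow_eq_rpow_re_of_pos hpos]
    gcongr
    simp only [Complex.neg_re, Complex.add_re, Complex.one_re]
    exact Real.rpow_le_rpow_of_nonpos (by positivity) (by linarith [hy.1]) (by linarith)

lemma exists_entire (a : UnitAddCircle) : ∃ E : ℂ → ℂ, Differentiable ℂ E ∧
    ∀ s ≠ 0, E s = s * HurwitzZeta.hurwitzZeta a (s + 1) := by
  refine ⟨Function.update (fun s => s * HurwitzZeta.hurwitzZeta a (s + 1)) 0 1, ?_, ?_⟩
  · have hd : ∀ s : ℂ, s ≠ 0 → DifferentiableAt ℂ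
        (Function.update (fun s => s * HurwitzZeta.hurwitzZeta a (s + 1)) 0 1) s := by
      intro s hs
      have h1 : DifferentiableAt ℂ (fun s => s * HurwitzZeta.hurwitzZeta a (s + 1)) s := by
        refine differentiableAt_id.mul ?_
        exact DifferentiableAt.comp s (HurwitzZeta.differentiableAt_hurwitzZeta a (by simpa using hs))
          (by fun_prop)
      refine h1.congr_of_eventuallyEq ?_
      filter_upwards [isOpen_ne.mem_nhds hs] with w hw
      exact Function.update_of_ne hw _ _
    intro s
    by_cases hs : s = 0
    · subst hs
      refine (Complex.analyticAt_of_differentiable_on_punctured_nhds_of_continuousAt ?_ ?_).differentiableAt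
      · filter_upwards [self_mem_nhdsWithin] with w hw using hd w hw
      · rw [continuousAt_update_same]
        have h := HurwitzZeta.hurwitzZeta_residue_one a
        have ht : Tendsto (fun s : ℂ => s + 1) (𝓝[≠] 0) (𝓝[≠] 1) := by
          refine tendsto_nhdsWithin_iff.2 ⟨?_, ?_⟩
          · have : Continuous fun s : ℂ => s + 1 := by fun_prop
            simpa using (this.tendsto 0).mono_left nhdsWithin_le_nhds
          · filter_upwards [self_mem_nhdsWithin] with w hw
            simpa using hw
        refine (h.comp ht).congr fun w => ?_
        simp
    · exact hd s hs
  · intro s hs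
    exact Function.update_of_ne hs _ _

/-- joint continuity gives locally uniform convergence -/
lemma locunif {U : Set ℂ} (hU : IsOpen U) {f : ℂ → ℝ → ℂ}
    (hf : ContinuousOn (fun p : ℂ × ℝ => f p.1 p.2) (U ×ˢ Ioo (0:ℝ) 1)) {t : ℝ} (ht : t ∈ Ioo (0:ℝ) 1)
    (s : ℂ) (hs : s ∈ U) (ε : ℝ) (hε : 0 < ε) :
    ∃ V ∈ 𝓝 s, ∃ δ > 0, ∀ w ∈ V, ∀ y ∈ Metric.ball t δ, ‖f w y - f w t‖ < ε := by
  have hc := hf.continuousAt ((hU.prod isOpen_Ioo).mem_nhds (⟨hs, ht⟩ : (s, t) ∈ U ×ˢ Ioo (0:ℝ) 1))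
  have := Metric.tendsto_nhds.1 hc (ε / 2) (by positivity)
  rw [nhds_prod_eq] at this
  obtain ⟨pa, ha, pb, hb, H⟩ := eventually_prod_iff.1 this
  obtain ⟨δ, hδ, hb'⟩ := Metric.eventually_nhds_iff_ball.1 hb
  refine ⟨{w | pa w}, ha, δ, hδ, fun w hw y hy => ?_⟩
  have h1 := H hw (hb' y hy)
  have h2 := H hw (hb' t (Metric.mem_ball_self hδ))
  rw [← dist_eq_norm]
  have := dist_triangle_right (f w y) (f w t) (f s t)
  simp only at h1 h2
  linarith

lemma deriv_cont {U : Set ℂ} (hU : IsOpen U) {f : ℂ → ℝ → ℂ}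
    (hf : ContinuousOn (fun p : ℂ × ℝ => f p.1 p.2) (U ×ˢ Ioo (0:ℝ) 1))
    (hd : ∀ t ∈ Ioo (0:ℝ) 1, DifferentiableOn ℂ (fun s => f s t) U) {s : ℂ} (hs : s ∈ U) :
    ContinuousOn (fun t => deriv (fun s => f s t) s) (Ioo 0 1) := by
  intro t ht
  have hT : TendstoLocallyUniformlyOn (fun (y : ℝ) (s : ℂ) => f s y) (fun s => f s t)
      (𝓝[Ioo 0 1] t) U := by
    rw [Metric.tendstoLocallyUniformlyOn_iff]
    intro ε hε w hw
    obtain ⟨V, hV, δ, hδ, H⟩ := locunif hU hf ht w hw ε hε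
    refine ⟨V, mem_nhdsWithin_of_mem_nhds hV, ?_⟩
    filter_upwards [mem_nhdsWithin_of_mem_nhds (Metric.ball_mem_nhds t hδ)] with y hy z hz
    rw [dist_comm, dist_eq_norm]
    exact H z hz y hy
  have := hT.deriv (by filter_upwards [self_mem_nhdsWithin] with y hy using hd y hy) hU
  exact this.tendsto_at hs

lemma int_cont {U : Set ℂ} (hU : IsOpen U) {f : ℂ → ℝ → ℂ}
    (hf : ContinuousOn (fun p : ℂ × ℝ => f p.1 p.2) (U ×ˢ Ioo (0:ℝ) 1)) {a : ℝ} (ha : a ∈ Ioo (0:ℝ) 1) :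
    ContinuousOn (fun p : ℂ × ℝ => ∫ t in a..p.2, f p.1 t) (U ×ˢ Ioo (0:ℝ) 1) := by
  have hrep : ∀ p : ℂ × ℝ, ∫ t in a..p.2, f p.1 t =
      (p.2 - a) • ∫ u in (0:ℝ)..1, f p.1 (a + (p.2 - a) * (projIcc (0:ℝ) 1 zero_le_one u : ℝ)) := by
    intro p
    have h1 : ∫ u in (0:ℝ)..1, f p.1 (a + (p.2 - a) * (projIcc (0:ℝ) 1 zero_le_one u : ℝ)) =
        ∫ u in (0:ℝ)..1, f p.1 (a + (p.2 - a) * u) := by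
      refine intervalIntegral.integral_congr fun u hu => ?_
      rw [uIcc_of_le zero_le_one] at hu
      simp only [projIcc_of_mem zero_le_one hu]
    rw [h1, intervalIntegral.smul_integral_comp_add_mul]
    simp
  rw [continuousOn_iff_continuous_domRestrict]
  have hX : Continuous fun p : (U ×ˢ Ioo (0:ℝ) 1 : Set (ℂ × ℝ)) =>
      ∫ u in (0:ℝ)..1, f p.1.1 (a + (p.1.2 - a) * (projIcc (0:ℝ) 1 zero_le_one u : ℝ)) := by
    refine intervalIntegral.continuous_parametric_intervalIntegral_of_continuous' ?_ 0 1
    refine hf.comp_continuous (f := fun q : (U ×ˢ Ioo (0:ℝ) 1 : Set (ℂ × ℝ)) × ℝ =>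
      (q.1.1.1, a + (q.1.1.2 - a) * (projIcc (0:ℝ) 1 zero_le_one q.2 : ℝ))) ?_ ?_
    · have : Continuous (fun u : ℝ => (projIcc (0:ℝ) 1 zero_le_one u : ℝ)) :=
        continuous_subtype_val.comp continuous_projIcc
      fun_prop
    · rintro ⟨⟨⟨s, x⟩, hs, hx⟩, u⟩
      refine ⟨hs, ?_⟩
      have h := (convex_Ioo (0:ℝ) 1).add_smul_sub_mem ha hx (projIcc (0:ℝ) 1 zero_le_one u).2
      simpa [mul_comm] using h
  have : (U ×ˢ Ioo (0:ℝ) 1).domRestrict (fun p : ℂ × ℝ => ∫ t in a..p.2, f p.1 t) =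
      fun p => (p.1.2 - a) • ∫ u in (0:ℝ)..1, f p.1.1 (a + (p.1.2 - a) * (projIcc (0:ℝ) 1 zero_le_one u : ℝ)) := by
    funext p; exact hrep p.1
  rw [this]
  have hX' : Continuous fun p : (U ×ˢ Ioo (0:ℝ) 1 : Set (ℂ × ℝ)) => p.1.2 - a := by fun_prop
  exact hX'.smul hX

lemma uIcc_sub {a x : ℝ} (ha : a ∈ Ioo (0:ℝ) 1) (hx : x ∈ Ioo (0:ℝ) 1) : uIcc a x ⊆ Ioo (0:ℝ) 1 :=
  ordConnected_Ioo.uIcc_subset ha hx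

lemma slice_cont {U : Set ℂ} {f : ℂ → ℝ → ℂ}
    (hf : ContinuousOn (fun p : ℂ × ℝ => f p.1 p.2) (U ×ˢ Ioo (0:ℝ) 1)) {s : ℂ} (hs : s ∈ U) :
    ContinuousOn (f s) (Ioo 0 1) :=
  hf.comp (f := fun t : ℝ => (s, t)) (by fun_prop) (fun _ ht => ⟨hs, ht⟩)

lemma int_diff {U : Set ℂ} (hU : IsOpen U) {f : ℂ → ℝ → ℂ}
    (hf : ContinuousOn (fun p : ℂ × ℝ => f p.1 p.2) (U ×ˢ Ioo (0:ℝ) 1))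
    (hd : ∀ t ∈ Ioo (0:ℝ) 1, DifferentiableOn ℂ (fun s => f s t) U)
    {a x : ℝ} (ha : a ∈ Ioo (0:ℝ) 1) (hx : x ∈ Ioo (0:ℝ) 1) :
    DifferentiableOn ℂ (fun s => ∫ t in a..x, f s t) U := by
  intro s hs
  obtain ⟨r, hr, hrU⟩ := Metric.isOpen_iff.1 hU s hs
  have hK : IsCompact (Metric.closedBall s (r/2) ×ˢ uIcc a x) :=
    (isCompact_closedBall s (r/2)).prod isCompact_uIcc
  have hballU : Metric.closedBall s (r/2) ⊆ U :=
    (Metric.closedBall_subset_ball (by linarith)).trans hrU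
  have hKs : Metric.closedBall s (r/2) ×ˢ uIcc a x ⊆ U ×ˢ Ioo (0:ℝ) 1 :=
    prod_mono hballU (uIcc_sub ha hx)
  obtain ⟨C, hC⟩ := hK.exists_bound_of_continuousOn (hf.mono hKs)
  have hsub : Ι a x ⊆ Ioo (0:ℝ) 1 := uIoc_subset_uIcc.trans (uIcc_sub ha hx)
  have := intervalIntegral.hasDerivAt_integral_of_dominated_loc_of_deriv_le (𝕜 := ℂ) (μ := volume)
    (F := f) (F' := fun s t => deriv (fun s => f s t) s) (x₀ := s) (s := Metric.ball s (r/4))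
    (a := a) (b := x) (bound := fun _ => C / (r/4)) (Metric.ball_mem_nhds s (by positivity))
    ?_ ?_ ?_ ?_ ?_ ?_
  · exact this.2.differentiableAt.differentiableWithinAt
  · filter_upwards [hU.mem_nhds hs] with w hw
    exact ((slice_cont hf hw).mono hsub).aestronglyMeasurable measurableSet_uIoc
  · exact ((slice_cont hf hs).mono (uIcc_sub ha hx)).intervalIntegrable
  · exact ((deriv_cont hU hf hd hs).mono hsub).aestronglyMeasurable measurableSet_uIoc
  · refine Eventually.of_forall fun t ht w hw => ?_
    have hcb : Metric.closedBall w (r/4) ⊆ Metric.closedBall s (r/2) := by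
      refine Metric.closedBall_subset_closedBall' ?_
      have := Metric.mem_ball.1 hw
      linarith
    refine Complex.norm_deriv_le_of_forall_mem_sphere_norm_le (by positivity) ?_ ?_
    · refine DifferentiableOn.diffContOnCl ?_
      refine (hd t (hsub ht)).mono ?_
      rw [closure_ball _ (by positivity)]
      exact hcb.trans hballU
    · intro z hz
      exact hC (z, t) ⟨hcb (Metric.sphere_subset_closedBall hz), uIoc_subset_uIcc ht⟩
  · simp
  · refine Eventually.of_forall fun t ht w hw => ?_
    refine ((hd t (hsub ht)).differentiableAt (hU.mem_nhds ?_)).hasDerivAt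
    refine hballU (Metric.closedBall_subset_closedBall (by linarith) (Metric.ball_subset_closedBall hw))

noncomputable def hzD (s : ℂ) (x : ℝ) : ℂ :=
  HurwitzZeta.hurwitzZeta (x : UnitAddCircle) s -
    HurwitzZeta.hurwitzZeta (((1/2 : ℝ)) : UnitAddCircle) s

lemma hzD_diff (x : ℝ) : Differentiable ℂ (fun s => hzD s x) :=
  HurwitzZeta.differentiable_hurwitzZeta_sub_hurwitzZeta _ _

lemma half_mem : (1/2 : ℝ) ∈ Ioo (0:ℝ) 1 := by constructor <;> norm_num

lemma hp_open (c : ℝ) : IsOpen {s : ℂ | c < s.re} := isOpen_lt continuous_const Complex.continuous_re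

lemma hzD_ident {E : ℂ → ℂ} (hE : Differentiable ℂ E)
    (hE' : ∀ s ≠ 0, E s = s * HurwitzZeta.hurwitzZeta ((1/2 : ℝ) : UnitAddCircle) (s + 1)) {c : ℝ}
    (hf : ContinuousOn (fun p : ℂ × ℝ => hzD (p.1 + 1) p.2) ({s : ℂ | c < s.re} ×ˢ Ioo (0:ℝ) 1))
    {x : ℝ} (hx : x ∈ Ioo (0:ℝ) 1) {s : ℂ} (hs : c < s.re) :
    hzD s x = -s * (∫ t in (1/2 : ℝ)..x, hzD (s + 1) t) - (x - (1/2 : ℝ) : ℝ) * E s := by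
  have hd : ∀ t ∈ Ioo (0:ℝ) 1, DifferentiableOn ℂ (fun s => hzD (s + 1) t) {s : ℂ | c < s.re} :=
    fun t _ => ((hzD_diff t).comp (differentiable_id.add_const 1)).differentiableOn
  have hI := int_diff (hp_open c) hf hd half_mem hx
  have hA : AnalyticOnNhd ℂ (fun s => hzD s x) {s : ℂ | c < s.re} :=
    (hzD_diff x).differentiableOn.analyticOnNhd (hp_open c)
  have hB : AnalyticOnNhd ℂ (fun s => -s * (∫ t in (1/2 : ℝ)..x, hzD (s + 1) t)
      - (x - (1/2 : ℝ) : ℝ) * E s) {s : ℂ | c < s.re} := by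
    refine DifferentiableOn.analyticOnNhd ?_ (hp_open c)
    exact (differentiable_id.neg.differentiableOn.mul hI).sub (hE.differentiableOn.const_mul _)
  have hpre : IsPreconnected {s : ℂ | c < s.re} := (convex_halfSpace_re_gt c).isPreconnected
  set z₀ : ℂ := ((max c 1 + 1 : ℝ) : ℂ) with hz
  have hz0 : z₀ ∈ {s : ℂ | c < s.re} := by
    simp only [hz, mem_ofPred_eq, Complex.ofReal_re]; linarith [le_max_left c 1]
  have hz1 : z₀ ∈ {s : ℂ | 1 < s.re} := by
    simp only [hz, mem_ofPred_eq, Complex.ofReal_re]; linarith [le_max_right c 1]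
  refine hA.eqOn_of_preconnected_of_eventuallyEq hB hpre hz0 ?_ hs
  filter_upwards [(hp_open 1).mem_nhds hz1, (hp_open c).mem_nhds hz0] with w hw hwc
  have hw0 : w ≠ 0 := by
    rintro rfl
    simp at hw
    linarith
  have hsl : ContinuousOn (fun t => hzD (w + 1) t) (uIcc (1/2 : ℝ) x) :=
    (slice_cont (f := fun s t => hzD (s + 1) t) hf hwc).mono (uIcc_sub half_mem hx)
  have hint := hsl.intervalIntegrable (μ := volume)
  have hFTC : ∫ t in (1/2 : ℝ)..x, (-w * hzD (w + 1) t - E w) = hzD w x - hzD w (1/2) := by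
    refine intervalIntegral.integral_eq_sub_of_hasDerivAt (fun t ht => ?_) ?_
    · have h := (hz_base_deriv hw (uIcc_sub half_mem hx ht)).sub_const
        (HurwitzZeta.hurwitzZeta (((1/2 : ℝ)) : UnitAddCircle) w)
      have he : -w * hzD (w + 1) t - E w = -w * HurwitzZeta.hurwitzZeta (t : UnitAddCircle) (w + 1) := by
        rw [hE' w hw0, hzD]; ring
      rw [he]
      exact h
    · exact (hint.const_mul _).sub intervalIntegrable_const
  rw [intervalIntegral.integral_sub (hint.const_mul _) intervalIntegrable_const,
    intervalIntegral.integral_const_mul, intervalIntegral.integral_const] at hFTC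
  have h0 : hzD w (1/2) = 0 := by simp [hzD]
  rw [h0, sub_zero] at hFTC
  simp only [← hFTC, Complex.real_smul]

lemma hzD_cont_aux (m : ℕ) : ContinuousOn (fun p : ℂ × ℝ => hzD p.1 p.2)
    ({s : ℂ | 1 - (m : ℝ) < s.re} ×ˢ Ioo (0:ℝ) 1) := by
  induction m with
  | zero =>
    simp only [Nat.cast_zero, sub_zero]
    refine hz_base_cont.sub ?_
    rintro p ⟨hp, -⟩
    refine ContinuousAt.continuousWithinAt ?_
    have hp1 : p.1 ≠ 1 := by
      intro h
      simp [h] at hp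
    exact ContinuousAt.comp (f := fun p : ℂ × ℝ => p.1) (x := p)
      (HurwitzZeta.differentiableAt_hurwitzZeta ((1/2 : ℝ) : UnitAddCircle) hp1).continuousAt
      continuousAt_fst
  | succ m ih =>
    obtain ⟨E, hE, hE'⟩ := exists_entire ((1/2 : ℝ) : UnitAddCircle)
    have hf : ContinuousOn (fun p : ℂ × ℝ => hzD (p.1 + 1) p.2)
        ({s : ℂ | 1 - ((m + 1 : ℕ) : ℝ) < s.re} ×ˢ Ioo (0:ℝ) 1) := by
      refine ih.comp (f := fun p : ℂ × ℝ => (p.1 + 1, p.2)) (by fun_prop) ?_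
      rintro p ⟨h1, h2⟩
      refine ⟨?_, h2⟩
      simp at h1 ⊢
      linarith
    have hI := int_cont (hp_open _) (f := fun s t => hzD (s + 1) t) hf half_mem
    have : ContinuousOn (fun p : ℂ × ℝ => -p.1 * (∫ t in (1/2 : ℝ)..p.2, hzD (p.1 + 1) t)
        - (p.2 - (1/2 : ℝ) : ℝ) * E p.1) ({s : ℂ | 1 - ((m + 1 : ℕ) : ℝ) < s.re} ×ˢ Ioo (0:ℝ) 1) := by
      have hEc := hE.continuous
      refine ContinuousOn.sub (ContinuousOn.mul (by fun_prop) hI) (by fun_prop)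
    refine this.congr ?_
    rintro p ⟨h1, h2⟩
    exact hzD_ident hE hE' hf h2 h1

lemma hzD_cont (U : Set ℂ) : ContinuousOn (fun p : ℂ × ℝ => hzD p.1 p.2) (U ×ˢ Ioo (0:ℝ) 1) := by
  rintro p ⟨-, hp⟩
  obtain ⟨m, hm⟩ := exists_nat_gt (1 - p.1.re)
  refine ((hzD_cont_aux m).continuousAt (((hp_open _).prod isOpen_Ioo).mem_nhds
    ⟨?_, hp⟩)).continuousWithinAt
  simp only [mem_ofPred_eq]; linarith

lemma hzD_hasDeriv {E : ℂ → ℂ} (hE : Differentiable ℂ E)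
    (hE' : ∀ s ≠ 0, E s = s * HurwitzZeta.hurwitzZeta ((1/2 : ℝ) : UnitAddCircle) (s + 1))
    {x : ℝ} (hx : x ∈ Ioo (0:ℝ) 1) (s : ℂ) :
    HasDerivAt (fun x => hzD s x) (-s * hzD (s + 1) x - E s) x := by
  have hc : ContinuousOn (fun t => hzD (s + 1) t) (Ioo 0 1) :=
    slice_cont (hzD_cont univ) (mem_univ _)
  have h1 : HasDerivAt (fun x => ∫ t in (1/2 : ℝ)..x, hzD (s + 1) t) (hzD (s + 1) x) x :=
    intervalIntegral.integral_hasDerivAt_right ((hc.mono (uIcc_sub half_mem hx)).intervalIntegrable)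
      (hc.stronglyMeasurableAtFilter isOpen_Ioo x hx) (hc.continuousAt (isOpen_Ioo.mem_nhds hx))
  have h2 : HasDerivAt (fun x : ℝ => ((x - (1/2 : ℝ) : ℝ) : ℂ) * E s) (E s) x := by
    simpa using (((hasDerivAt_id x).sub_const (1/2 : ℝ)).ofReal_comp).mul_const (E s)
  refine ((h1.const_mul (-s)).sub h2).congr_of_eventuallyEq ?_
  filter_upwards [isOpen_Ioo.mem_nhds hx] with y hy
  refine hzD_ident hE hE' (c := s.re - 1) ?_ hy (by linarith)
  exact (hzD_cont univ).comp (f := fun p : ℂ × ℝ => (p.1 + 1, p.2)) (by fun_prop)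
    (fun p hp => ⟨mem_univ _, hp.2⟩)

lemma iter_tendsto {ι : Type*} {l : Filter ι} [l.NeBot] (k : ℕ) : ∀ {F : ι → ℂ → ℂ} {f : ℂ → ℂ},
    TendstoLocallyUniformlyOn F f l univ → (∀ i, Differentiable ℂ (F i)) → 
    ∀ s, Tendsto (fun i => iteratedDeriv k (F i) s) l (𝓝 (iteratedDeriv k f s)) := by
  induction k with
  | zero => intro F f h _ s; simpa using h.tendsto_at (mem_univ s)
  | succ k ih =>
    intro F f h hd s
    simp only [iteratedDeriv_succ']
    refine ih (F := fun i => deriv (F i)) ?_ ?_ s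
    · exact h.deriv (Eventually.of_forall fun i => (hd i).differentiableOn) isOpen_univ
    · exact fun i => (hd i).deriv

lemma swap {F P : ℂ → ℝ → ℂ} (hF : ∀ x, Differentiable ℂ (fun s => F s x))
    (hP : ContinuousOn (fun p : ℂ × ℝ => P p.1 p.2) (univ ×ˢ Ioo (0:ℝ) 1))
    (hFP : ∀ s, ∀ x ∈ Ioo (0:ℝ) 1, HasDerivAt (fun x => F s x) (P s x) x)
    (k : ℕ) (s : ℂ) {x : ℝ} (hx : x ∈ Ioo (0:ℝ) 1) :
    HasDerivAt (fun x => iteratedDeriv k (fun s => F s x) s) (iteratedDeriv k (fun s => P s x) s) x := by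
  rw [hasDerivAt_iff_tendsto_slope]
  have hT : TendstoLocallyUniformlyOn (fun (y : ℝ) (s : ℂ) => (((y - x)⁻¹ : ℝ) : ℂ) * (F s y - F s x))
      (fun s => P s x) (𝓝[≠] x) univ := by
    rw [Metric.tendstoLocallyUniformlyOn_iff]
    intro ε hε w hw
    obtain ⟨V, hV, δ, hδ, H⟩ := locunif isOpen_univ hP hx w hw (ε/2) (by positivity)
    obtain ⟨δ', hδ', hb⟩ := Metric.isOpen_iff.1 isOpen_Ioo x hx
    refine ⟨V, mem_nhdsWithin_of_mem_nhds hV, ?_⟩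
    filter_upwards [mem_nhdsWithin_of_mem_nhds (Metric.ball_mem_nhds x (lt_min hδ hδ')),
      self_mem_nhdsWithin] with y hy hne z hz
    have hsub : Metric.ball x (min δ δ') ⊆ Ioo 0 1 :=
      (Metric.ball_subset_ball (min_le_right _ _)).trans hb
    have hmv := (convex_ball x (min δ δ')).norm_image_sub_le_of_norm_hasDerivWithin_le
      (f := fun t : ℝ => F z t - (t : ℂ) * P z x) (f' := fun t => P z t - P z x) (C := ε/2)
      (x := x) (y := y) ?_ ?_ (Metric.mem_ball_self (lt_min hδ hδ')) hy
    · have hyx : y - x ≠ 0 := sub_ne_zero.2 hne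
      have hyx' : ((y - x : ℝ) : ℂ) ≠ 0 := by exact_mod_cast hyx
      have hrw : (((y - x)⁻¹ : ℝ) : ℂ) * (F z y - F z x) - P z x =
          (((y - x)⁻¹ : ℝ) : ℂ) * ((F z y - (y : ℂ) * P z x) - (F z x - (x : ℂ) * P z x)) := by
        rw [Complex.ofReal_inv]
        field_simp
        push_cast
        ring
      rw [dist_comm, dist_eq_norm, hrw, norm_mul, Complex.norm_real, norm_inv]
      have hp : 0 < ‖y - x‖ := norm_pos_iff.2 hyx
      calc _ ≤ ‖y - x‖⁻¹ * (ε / 2 * ‖y - x‖) := by gcongr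
        _ = ε / 2 := by field_simp
        _ < ε := by linarith
    · intro t ht
      have h2 : HasDerivAt (fun t : ℝ => (t : ℂ) * P z x) (P z x) t := by
        simpa using ((hasDerivAt_id t).ofReal_comp).mul_const (P z x)
      exact ((hFP z t (hsub ht)).sub h2).hasDerivWithinAt
    · intro t ht
      exact (H z hz t (Metric.ball_subset_ball (min_le_left _ _) ht)).le
  have := iter_tendsto k hT (fun y => ((hF y).sub (hF x)).const_mul _) s
  refine this.congr fun y => ?_
  rw [iteratedDeriv_const_mul_field, slope_def_module, Complex.real_smul]
  congr 1
  exact iteratedDeriv_sub (hF y).contDiff.contDiffAt (hF x).contDiff.contDiffAt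

theorem stmt_9 (r₁ r₂ : ℕ) (α : ℝ) (hα0 : 0 < α) (hα1 : α < 1)
    (s : ℂ) (hs : ∀ j : ℕ, j ≤ r₁ → s ≠ 1 - (j : ℂ)) :
    iteratedDeriv r₁
        (fun x : ℝ =>
          iteratedDeriv r₂ (fun w => HurwitzZeta.hurwitzZeta (x : UnitAddCircle) w) s) α
      = iteratedDeriv r₂
          (fun w =>
            (-1) ^ r₁ * (∏ j ∈ Finset.range r₁, (w + (j : ℂ))) *
              HurwitzZeta.hurwitzZeta (α : UnitAddCircle) (w + r₁)) s := by
  obtain ⟨E, hE, hE'⟩ := exists_entire ((1/2 : ℝ) : UnitAddCircle)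
  have hα : α ∈ Ioo (0:ℝ) 1 := ⟨hα0, hα1⟩
  clear hα0 hα1
  induction r₁ generalizing α with
  | zero => simp
  | succ r ih =>
    have hs0 : s + r ≠ 1 := fun h => hs r (by omega) (by rw [← h]; ring)
    have hs1 : s + r ≠ 0 := fun h => hs (r + 1) le_rfl (by push_cast; linear_combination h)
    rw [iteratedDeriv_succ]
    set c : ℂ → ℂ := fun w => (-1) ^ r * ∏ j ∈ Finset.range r, (w + (j : ℂ)) with hc
    have hcd : Differentiable ℂ c := by rw [hc]; fun_prop
    have hEc := hE.continuous
    have hcc := hcd.continuous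
    have hsw := swap (F := fun w x => c w * hzD (w + r) x)
      (P := fun w x => c w * (-(w + r) * hzD (w + r + 1) x - E (w + r))) ?_ ?_ ?_ r₂ s hα
    · have hev : (fun y : ℝ => iteratedDeriv r (fun x : ℝ =>
          iteratedDeriv r₂ (fun w => HurwitzZeta.hurwitzZeta (x : UnitAddCircle) w) s) y) =ᶠ[𝓝 α]
          fun y => iteratedDeriv r₂ (fun w => c w * hzD (w + r) y) s + iteratedDeriv r₂ (fun w =>
            c w * HurwitzZeta.hurwitzZeta ((1/2 : ℝ) : UnitAddCircle) (w + r)) s := by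
        filter_upwards [isOpen_Ioo.mem_nhds hα] with y hy
        rw [ih y (fun j hj => hs j (by omega)) hy]
        have h1 : ContDiffAt ℂ r₂ (fun w => c w * hzD (w + r) y) s :=
          (hcd.mul ((hzD_diff y).comp (differentiable_id.add_const (r:ℂ)))).contDiff.contDiffAt
        have h2 : ContDiffAt ℂ r₂ (fun w =>
            c w * HurwitzZeta.hurwitzZeta ((1/2 : ℝ) : UnitAddCircle) (w + r)) s := by
          have : DifferentiableOn ℂ (fun w =>
            c w * HurwitzZeta.hurwitzZeta ((1/2 : ℝ) : UnitAddCircle) (w + r)) {w | w + r ≠ 1} := by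
            intro w hw
            refine DifferentiableAt.differentiableWithinAt ?_
            have hw' : w + (r : ℂ) ≠ 1 := hw
            exact (hcd w).mul (DifferentiableAt.comp (f := fun w : ℂ => w + r) w
              (HurwitzZeta.differentiableAt_hurwitzZeta _ hw') (by fun_prop))
          exact (this.analyticAt ((isOpen_ne_fun (by fun_prop) (by fun_prop)).mem_nhds hs0)).contDiffAt
        rw [← iteratedDeriv_fun_add h1 h2]
        congr 1
        funext w
        simp only [hzD, hc]
        ring
      rw [hev.deriv_eq, (hsw.add_const _).deriv]
      refine Filter.EventuallyEq.iteratedDeriv_eq r₂ ?_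
      filter_upwards [(isOpen_ne_fun (f := fun w : ℂ => w + r) (g := fun _ => 0)
        (by fun_prop) (by fun_prop)).mem_nhds hs1] with w hw
      rw [hE' _ hw, Finset.prod_range_succ]
      simp only [hzD, hc]
      push_cast
      rw [add_assoc w]
      ring
    · exact fun x => hcd.mul ((hzD_diff x).comp (differentiable_id.add_const (r:ℂ)))
    · have h1 : ContinuousOn (fun p : ℂ × ℝ => hzD (p.1 + r + 1) p.2) (univ ×ˢ Ioo (0:ℝ) 1) :=
        (hzD_cont univ).comp (f := fun p : ℂ × ℝ => (p.1 + r + 1, p.2)) (by fun_prop)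
          (fun p hp => ⟨mem_univ _, hp.2⟩)
      refine ContinuousOn.mul (by fun_prop) (ContinuousOn.sub (ContinuousOn.mul (by fun_prop) h1)
        (by fun_prop))
    · intro w x hx
      exact (hzD_hasDeriv hE hE' hx (w + r)).const_mul (c w)
end
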